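/- arXiv:2403.07597 — 2 statements merged into one kernel-verified Lean document; each statement's English description precedes it below -/
import Mathlib

section
/- Let D be a semicomplete multipartite digraph and let F be an irreducible G-cycle factor of D. Then the G-cycles of F can be labelled C_1^g, ..., C_k^g such that C_i^g ≃> C_j^g for all i < j. -/
open Classical

universe u v

/-- A semicomplete multipartite digraph: `A` is the arc relation and `part` assigns to
each vertex its partite set.  There are no arcs inside a partite set and at least one
arc between any two vertices of different partite sets. -/
structure IsSMD {V : Type u} {K : Type v} (A : V → V → Prop) (part : V → K) : Prop where
  noInside : ∀ x y : V, part x = part y → ¬ A x y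
  adj : ∀ x y : V, part x ≠ part y → A x y ∨ A y x

/-- An extended semicomplete digraph: a semicomplete multipartite digraph in which any
two vertices of the same partite set have identical in- and out-neighbourhoods. -/
def IsESD {V : Type u} {K : Type v} (A : V → V → Prop) (part : V → K) : Prop :=
  IsSMD A part ∧ ∀ x y : V, part x = part y →
    (∀ z, A x z ↔ A y z) ∧ (∀ z, A z x ↔ A z y)

/-- A generalized path (G-path): a sequence of distinct vertices in which each
consecutive pair is either an arc or a pair of vertices in the same partite set. -/
structure GPath {V : Type u} {K : Type v} (A : V → V → Prop) (part : V → K) where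
  verts : List V
  ne : verts ≠ []
  nodup : verts.Nodup
  chain : verts.Chain' fun a b => A a b ∨ part a = part b

/-- A generalized cycle (G-cycle): as a G-path, but also the pair consisting of the
last and the first vertex is an arc or lies in one partite set. -/
structure GCycle {V : Type u} {K : Type v} (A : V → V → Prop) (part : V → K)
    extends GPath A part where
  close : A (verts.getLast ne) (verts.head ne) ∨
    part (verts.getLast ne) = part (verts.head ne)

variable {V : Type u} {K : Type v} {A : V → V → Prop} {part : V → K}

/-- The length of a G-path: the number of arcs it uses. -/
noncomputable def GPath.len (P : GPath A part) : ℕ :=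
  (P.verts.zip P.verts.tail).countP fun q => decide (A q.1 q.2)

/-- The length of a G-cycle: the number of arcs it uses (cyclically). -/
noncomputable def GCycle.len (C : GCycle A part) : ℕ :=
  (C.toGPath.verts.zip (C.toGPath.verts.rotate 1)).countP fun q => decide (A q.1 q.2)

/-- `x` and `y` are (cyclically) consecutive on the G-cycle `C`, `y` following `x`. -/
def GCycle.consec (C : GCycle A part) (x y : V) : Prop :=
  (x, y) ∈ C.toGPath.verts.zip (C.toGPath.verts.rotate 1)

/-- The pair `(x, y)` (an `(x,y)`-G-path) has a partner on the G-cycle `C`: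
there are consecutive vertices `w, w'` of `C` with `w → x` and `y → w'`. -/
def GCycle.partner (C : GCycle A part) (x y : V) : Prop :=
  ∃ w w' : V, C.consec w w' ∧ A w x ∧ A y w'

/-- `v` is out-singular with respect to `C` (that is, `v ⇒ C`). -/
def GCycle.OutSingular (C : GCycle A part) (v : V) : Prop :=
  ∀ w ∈ C.toGPath.verts, (part v ≠ part w → A v w) ∧ ¬ A w v

/-- `v` is in-singular with respect to `C` (that is, `C ⇒ v`). -/
def GCycle.InSingular (C : GCycle A part) (v : V) : Prop :=
  ∀ w ∈ C.toGPath.verts, (part v ≠ part w → A w v) ∧ ¬ A v w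

/-- `v` is singular with respect to `C`. -/
def GCycle.SingularWrt (C : GCycle A part) (v : V) : Prop :=
  C.OutSingular v ∨ C.InSingular v

/-- `C₁ ≃> C₂`: `C₁` has singular vertices w.r.t. `C₂`, all of which are out-singular,
and `C₂` has singular vertices w.r.t. `C₁`, all of which are in-singular. -/
def SimGt (C₁ C₂ : GCycle A part) : Prop :=
  (∃ v ∈ C₁.toGPath.verts, C₂.SingularWrt v) ∧
  (∀ v ∈ C₁.toGPath.verts, C₂.SingularWrt v → C₂.OutSingular v) ∧
  (∃ v ∈ C₂.toGPath.verts, C₁.SingularWrt v) ∧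
  (∀ v ∈ C₂.toGPath.verts, C₁.SingularWrt v → C₁.InSingular v)

/-- A G-cycle subdigraph: a collection of pairwise vertex-disjoint G-cycles. -/
structure GCSub {V' : Type u} {K' : Type v} (A' : V' → V' → Prop) (part' : V' → K') where
  cycles : List (GCycle A' part')
  disj : cycles.Pairwise fun C C' => ∀ x ∈ C.toGPath.verts, x ∉ C'.toGPath.verts

/-- The total number of arcs used by a G-cycle subdigraph. -/
noncomputable def GCSub.arcs (F : GCSub A part) : ℕ :=
  (F.cycles.map GCycle.len).sum

/-- A G-cycle factor: a G-cycle subdigraph covering all vertices. -/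
def GCSub.IsFactor (F : GCSub A part) : Prop :=
  ∀ v : V, ∃ C ∈ F.cycles, v ∈ C.toGPath.verts

/-- Strong connectivity of a digraph. -/
def IsStrong (A : V → V → Prop) : Prop :=
  ∀ x y : V, Relation.ReflTransGen A x y

/-- Strong connectivity after deleting the vertex set `X`. -/
def IsStrongOutside (A : V → V → Prop) (X : Set V) : Prop :=
  ∀ x y : V, x ∉ X → y ∉ X →
    Relation.ReflTransGen (fun a b => A a b ∧ a ∉ X ∧ b ∉ X) x y

/-- `k`-strong connectivity. -/
def KStrong [Fintype V] (A : V → V → Prop) (k : ℕ) : Prop :=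
  k + 1 ≤ Fintype.card V ∧
    ∀ X : Finset V, X.card ≤ k - 1 → IsStrongOutside A (↑X : Set V)

namespace GFactor

/-! ### Weighted walks in lists -/

/-- The total weight of the consecutive pairs of a list. -/
def pw (w : V → V → ℤ) : List V → ℤ
  | [] => 0
  | [_] => 0
  | a :: b :: l => w a b + pw w (b :: l)

/-- The total weight of the cyclically consecutive pairs of a list. -/
def cw (w : V → V → ℤ) : List V → ℤ
  | [] => 0
  | a :: l => pw w (a :: l ++ [a])

/-- The list `l` starts with `a` and ends with `b`. -/
def Ends (l : List V) (a b : V) : Prop := l.head? = some a ∧ l.getLast? = some b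

/-- `b` directly follows `a` in the list `l`. -/
def Adj (l : List V) (a b : V) : Prop := ∃ r t, l = r ++ a :: b :: t

/-- `b` cyclically follows `a` in the list `l`. -/
def CEdge (l : List V) (a b : V) : Prop := Adj l a b ∨ Ends l b a

section Lists

variable {w : V → V → ℤ}

lemma pw_split (r t : List V) (a b : V) :
    pw w (r ++ a :: b :: t) = pw w (r ++ [a]) + w a b + pw w (b :: t) := by
  induction r with
  | nil => simp [pw]
  | cons x r ih =>
    cases r with
    | nil => simp [pw]; ring
    | cons y r => simp only [List.cons_append, pw] at ih ⊢; rw [ih]; ring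

lemma Ends.ne_nil {l : List V} {a b : V} (h : Ends l a b) : l ≠ [] := by
  rintro rfl; simp [Ends] at h

lemma Ends.exists_concat {l : List V} {a b : V} (h : Ends l a b) : ∃ r, l = r ++ [b] := by
  obtain ⟨r, hr⟩ := List.getLast?_eq_some_iff.1 h.2
  exact ⟨r, hr⟩

lemma Ends.exists_cons {l : List V} {a b : V} (h : Ends l a b) : ∃ r, l = a :: r := by
  obtain ⟨r, hr⟩ := List.head?_eq_some_iff.1 h.1
  exact ⟨r, hr⟩

lemma ends_singleton (a : V) : Ends [a] a a := by simp [Ends]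

lemma exists_ends {l : List V} (h : l ≠ []) : ∃ a b, Ends l a b :=
  ⟨l.head h, l.getLast h, List.head?_eq_some_head h, List.getLast?_eq_some_getLast h⟩

lemma Ends.append {l₁ l₂ : List V} {a b c d : V} (h₁ : Ends l₁ a b) (h₂ : Ends l₂ c d) :
    Ends (l₁ ++ l₂) a d := by
  simp [Ends, List.head?_append, List.getLast?_append, h₁.1, h₂.2]

lemma Ends.unique {l : List V} {a b c d : V} (h₁ : Ends l a b) (h₂ : Ends l c d) :
    a = c ∧ b = d := by
  have h3 := h₁.1.symm.trans h₂.1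
  have h4 := h₁.2.symm.trans h₂.2
  simpa using And.intro h3 h4

lemma pw_append {l₁ l₂ : List V} {a b c d : V} (h₁ : Ends l₁ a b) (h₂ : Ends l₂ c d) :
    pw w (l₁ ++ l₂) = pw w l₁ + w b c + pw w l₂ := by
  obtain ⟨r, rfl⟩ := h₁.exists_concat
  obtain ⟨t, rfl⟩ := h₂.exists_cons
  simpa using pw_split r t b c

lemma cw_eq {l : List V} {a b : V} (h : Ends l a b) : cw w l = pw w l + w b a := by
  obtain ⟨t, rfl⟩ := h.exists_cons
  simp only [cw]
  rw [pw_append h (ends_singleton a)]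
  simp [pw]

lemma cw_append_comm (l₁ l₂ : List V) : cw w (l₁ ++ l₂) = cw w (l₂ ++ l₁) := by
  rcases eq_or_ne l₁ [] with rfl | h₁
  · simp
  rcases eq_or_ne l₂ [] with rfl | h₂
  · simp
  obtain ⟨a, b, hab⟩ := exists_ends h₁
  obtain ⟨c, d, hcd⟩ := exists_ends h₂
  rw [cw_eq (hab.append hcd), cw_eq (hcd.append hab), pw_append hab hcd, pw_append hcd hab]
  ring

lemma isRotated_iff_append {l l' : List V} :
    l ~r l' ↔ ∃ r t, l = r ++ t ∧ l' = t ++ r := by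
  constructor
  · rintro ⟨k, rfl⟩
    refine ⟨l.take (k % l.length), l.drop (k % l.length), by simp, ?_⟩
    rw [List.rotate_eq_drop_append_take_mod]
  · rintro ⟨r, t, rfl, rfl⟩
    exact List.isRotated_append

lemma cw_rotated {l l' : List V} (h : l ~r l') : cw w l = cw w l' := by
  obtain ⟨r, t, rfl, rfl⟩ := isRotated_iff_append.1 h
  exact cw_append_comm r t

lemma Adj.append_right {l : List V} {a b : V} (h : Adj l a b) (t : List V) :
    Adj (l ++ t) a b := by
  obtain ⟨r, s, rfl⟩ := h
  exact ⟨r, s ++ t, by simp⟩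

lemma Adj.append_left {l : List V} {a b : V} (h : Adj l a b) (t : List V) :
    Adj (t ++ l) a b := by
  obtain ⟨r, s, rfl⟩ := h
  exact ⟨t ++ r, s, by simp⟩

lemma adj_append {l₁ l₂ : List V} {a b c d : V} (h₁ : Ends l₁ a b) (h₂ : Ends l₂ c d) :
    Adj (l₁ ++ l₂) b c := by
  obtain ⟨r, rfl⟩ := h₁.exists_concat
  obtain ⟨t, rfl⟩ := h₂.exists_cons
  exact ⟨r, t, by simp⟩

lemma adj_append_cases {l₁ l₂ : List V} {a b : V} (h : Adj (l₁ ++ l₂) a b) :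
    Adj l₁ a b ∨ Adj l₂ a b ∨ (l₁.getLast? = some a ∧ l₂.head? = some b) := by
  obtain ⟨r, t, h⟩ := h
  rcases List.append_eq_append_iff.1 h with ⟨s, h1, h2⟩ | ⟨s, h1, h2⟩
  · exact Or.inr (Or.inl ⟨s, t, h2⟩)
  · rcases s with _ | ⟨x, s⟩
    · simp at h1 h2
      exact Or.inr (Or.inl ⟨[], t, by simp [h2]⟩)
    · rcases s with _ | ⟨y, s⟩
      · simp at h2
        obtain ⟨rfl, rfl⟩ := h2
        exact Or.inr (Or.inr (by simp [h1]))
      · simp at h2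
        obtain ⟨rfl, rfl, rfl⟩ := h2
        exact Or.inl ⟨r, s, by simp [h1]⟩

lemma CEdge.rotated {l l' : List V} {a b : V} (h : CEdge l a b) (hr : l ~r l') :
    CEdge l' a b := by
  obtain ⟨r, t, rfl, rfl⟩ := isRotated_iff_append.1 hr
  rcases eq_or_ne r [] with rfl | hr
  · simpa using h
  rcases eq_or_ne t [] with rfl | ht
  · simpa using h
  obtain ⟨p, q, hpq⟩ := exists_ends hr
  obtain ⟨u, v, huv⟩ := exists_ends ht
  rcases h with h | h
  · rcases adj_append_cases h with h | h | ⟨h1, h2⟩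
    · exact Or.inl (h.append_left _)
    · exact Or.inl (h.append_right _)
    · obtain rfl : q = a := by simpa using hpq.2.symm.trans h1
      obtain rfl : u = b := by simpa using huv.1.symm.trans h2
      exact Or.inr (huv.append hpq)
  · obtain ⟨rfl, rfl⟩ := (hpq.append huv).unique h
    exact Or.inl (adj_append huv hpq)

lemma CEdge.exists_rotated {l : List V} {a b : V} (h : CEdge l a b) :
    ∃ l', l ~r l' ∧ Ends l' b a := by
  rcases h with ⟨r, t, rfl⟩ | h
  · refine ⟨b :: t ++ (r ++ [a]), ?_, ?_⟩
    · rw [isRotated_iff_append]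
      exact ⟨r ++ [a], b :: t, by simp, rfl⟩
    · refine ⟨by simp, ?_⟩
      rw [← List.append_assoc, List.getLast?_concat]
  · exact ⟨l, List.IsRotated.refl l, h⟩

/-- The nonempty list `P` can be inserted between two cyclically consecutive entries of `l`
with both new pairs having weight one. -/
def Fits (w : V → V → ℤ) (l P : List V) : Prop :=
  ∃ a b v v', Ends P a b ∧ CEdge l v v' ∧ w v a = 1 ∧ w b v' = 1

lemma exists_last_split {α : Type*} (p : α → Prop) :
    ∀ L : List α, (∃ x ∈ L, p x) →
      ∃ L₁ x L₂, L = L₁ ++ x :: L₂ ∧ p x ∧ ∀ y ∈ L₂, ¬ p y := by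
  intro L
  induction L with
  | nil => simp
  | cons a L ih =>
    rintro ⟨x, hx, hp⟩
    by_cases hL : ∃ x ∈ L, p x
    · obtain ⟨L₁, x, L₂, rfl, h1, h2⟩ := ih hL
      exact ⟨a :: L₁, x, L₂, rfl, h1, h2⟩
    · push Not at hL
      rcases List.mem_cons.1 hx with rfl | hx
      · exact ⟨[], x, L, rfl, hp, hL⟩
      · exact absurd hp (hL x hx)

/-- Simultaneous insertion of consecutive segments of a path into a cycle. -/
lemma multi_insert (hw : ∀ x y, w x y ≤ 1) :
    ∀ (k : ℕ) (Ps : List (List V)) (l : List V), Ps.length ≤ k → Ps ≠ [] →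
      (∀ P ∈ Ps, Fits w l P) →
      ∃ l', l'.Perm (l ++ Ps.flatten) ∧ cw w l + pw w Ps.flatten + 1 ≤ cw w l' := by
  intro k
  induction k with
  | zero =>
    intro Ps l h1 h2
    exact absurd (List.length_eq_zero_iff.1 (Nat.le_zero.1 h1)) h2
  | succ k ih =>
    intro Ps l hk hne hfit
    obtain ⟨P, Qs, rfl⟩ := List.exists_cons_of_ne_nil hne
    obtain ⟨a, b, v, v', hP, hv, hva, hbv⟩ := hfit P (by simp)
    obtain ⟨L₁, X, L₂, hL, ⟨hX1, hX2⟩, hX3⟩ := exists_last_split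
      (fun X : List V => X ∈ P :: Qs ∧ ∃ p q, Ends X p q ∧ w v p = 1 ∧ w q v' = 1)
      (P :: Qs) ⟨P, by simp, by simp, a, b, hP, hva, hbv⟩
    obtain ⟨p, q, hpq, -, hqv⟩ := hX2
    have hPre : ∃ t, Ends (L₁ ++ [X]).flatten a t ∧ w t v' = 1 := by
      refine ⟨q, ?_, hqv⟩
      rcases L₁ with _ | ⟨Y, L₁⟩
      · obtain ⟨rfl, -⟩ := List.cons.inj hL
        obtain ⟨rfl, rfl⟩ := hP.unique hpq
        simpa using hP
      · obtain ⟨rfl, -⟩ := List.cons.inj hL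
        have : (P :: L₁ ++ [X]).flatten = (P ++ L₁.flatten) ++ X := by simp
        rw [this]
        refine ⟨?_, by simp [List.getLast?_append, hpq.2]⟩
        simp [List.head?_append, hP.1]
    obtain ⟨t, hT, htv⟩ := hPre
    obtain ⟨l₁, hl₁, hE⟩ := hv.exists_rotated
    set T := (L₁ ++ [X]).flatten with hTdef
    have hflat : (P :: Qs).flatten = T ++ L₂.flatten := by rw [hL]; simp [hTdef]
    have hc : cw w l + pw w T + 1 ≤ cw w (l₁ ++ T) := by
      rw [cw_eq (hE.append hT), pw_append hE hT, cw_rotated hl₁, cw_eq hE, hva, htv]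
      linarith [hw v v']
    have hperm : (l₁ ++ T).Perm (l ++ T) := hl₁.perm.symm.append_right T
    rcases eq_or_ne L₂ [] with hL2 | hL2
    · refine ⟨l₁ ++ T, ?_, ?_⟩
      · rw [hflat, hL2]; simpa using hperm
      · rw [hflat, hL2]; simpa using hc
    · obtain ⟨l', h1, h2⟩ := ih L₂ (l₁ ++ T) (by
        have := congrArg List.length hL
        simp at this hk
        omega) hL2 (by
        intro B hB
        obtain ⟨a', b', u, u', h1, h2, h3, h4⟩ := hfit B (by rw [hL]; simp [hB])
        refine ⟨a', b', u, u', h1, Or.inl ?_, h3, h4⟩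
        rcases h2.rotated hl₁ with h | h
        · exact h.append_right T
        · obtain ⟨rfl, rfl⟩ := hE.unique h
          exact absurd ⟨by rw [hL]; simp [hB], a', b', h1, h3, h4⟩ (hX3 B hB))
      refine ⟨l', ?_, ?_⟩
      · rw [hflat, ← List.append_assoc]
        exact h1.trans (hperm.append_right _)
      · have hne2 : L₂.flatten ≠ [] := by
          obtain ⟨B, Bs, rfl⟩ := List.exists_cons_of_ne_nil hL2
          obtain ⟨a', b', -, -, h1, -⟩ := hfit B (by rw [hL]; simp)
          have := h1.ne_nil
          simp [this]
        obtain ⟨e, f, hef⟩ := exists_ends hne2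
        rw [hflat, pw_append hT hef]
        linarith [hw t e]

end Lists

/-! ### Arc weights and periodic parametrizations of G-cycles -/

/-- A weight function on pairs counting the arcs used by a walk, with a heavy penalty for pairs
which a G-cycle may not use. -/
structure Wt (A : V → V → Prop) (part : V → K) (w : V → V → ℤ) : Prop where
  smd : IsSMD A part
  arc : ∀ {x y}, A x y → w x y = 1
  same : ∀ {x y}, part x = part y → w x y = 0
  pen : ∀ {x y}, ¬ A x y → part x ≠ part y → w x y ≤ -10

/-- The function `c` runs around a G-cycle with period `n`. -/
structure Cyc (A : V → V → Prop) (part : V → K) (c : ℤ → V) (n : ℤ) : Prop where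
  pos : 0 < n
  per : ∀ i, c (i + n) = c i
  edge : ∀ i, A (c i) (c (i + 1)) ∨ part (c i) = part (c (i + 1))

/-- The list `c i, …, c (j - 1)`. -/
def sg (c : ℤ → V) (i j : ℤ) : List V := (List.range (j - i).toNat).map fun k : ℕ => c (i + k)

section Basic

variable {w : V → V → ℤ} {c d : ℤ → V} {n m : ℤ}

lemma Wt.cases (W : Wt A part w) (x y : V) :
    (A x y ∧ part x ≠ part y ∧ w x y = 1) ∨ (¬ A x y ∧ ¬ A y x ∧ part x = part y ∧ w x y = 0) ∨
      (¬ A x y ∧ A y x ∧ part x ≠ part y ∧ w x y ≤ -10) := by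
  by_cases hp : part x = part y
  · exact Or.inr (Or.inl ⟨W.smd.noInside _ _ hp, W.smd.noInside _ _ hp.symm, hp, W.same hp⟩)
  · by_cases hA : A x y
    · exact Or.inl ⟨hA, hp, W.arc hA⟩
    · exact Or.inr (Or.inr ⟨hA, (W.smd.adj _ _ hp).resolve_left hA, hp, W.pen hA hp⟩)

lemma Wt.le_one (W : Wt A part w) (x y : V) : w x y ≤ 1 := by
  rcases W.cases x y with h | h | h <;> omega

lemma Wt.ne (W : Wt A part w) {x y : V} (h : A x y) : part x ≠ part y :=
  fun hp => W.smd.noInside _ _ hp h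

lemma Wt.arc_of_not (W : Wt A part w) {x y : V} (h : ¬ A x y) (hp : part x ≠ part y) : A y x :=
  (W.smd.adj _ _ hp).resolve_left h

lemma Cyc.nonneg (W : Wt A part w) (hc : Cyc A part c n) (i : ℤ) : 0 ≤ w (c i) (c (i + 1)) := by
  rcases hc.edge i with h | h
  · simp [W.arc h]
  · simp [W.same h]

lemma Cyc.per_sub (hc : Cyc A part c n) (i : ℤ) : c (i - n) = c i := by
  simpa using (hc.per (i - n)).symm

lemma Cyc.per_mul (hc : Cyc A part c n) (i k : ℤ) : c (i + n * k) = c i := by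
  induction k with
  | zero => simp
  | succ k ih => rw [← ih, ← hc.per (i + n * k)]; congr 1; ring
  | pred k ih => rw [← ih, ← hc.per (i + n * (-k - 1))]; congr 1; ring

/-- Every position of a cycle is represented in any window of length one period. -/
lemma Cyc.window (hc : Cyc A part c n) (i k : ℤ) : ∃ q, k ≤ i + n * q ∧ i + n * q < k + n := by
  refine ⟨-((i - k) / n), ?_, ?_⟩
  · have := Int.mul_ediv_self_le (x := i - k) hc.pos.ne'
    linarith
  · have := Int.lt_mul_ediv_self_add (x := i - k) hc.pos
    linarith

/-- A property of vertices holding somewhere on a cycle holds at a position in any given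
window. -/
lemma Cyc.exists_window (hc : Cyc A part c n) {p : V → Prop} (h : ∃ i, p (c i)) (k : ℤ) :
    ∃ i, k ≤ i ∧ i < k + n ∧ p (c i) := by
  obtain ⟨i, hi⟩ := h
  obtain ⟨q, h1, h2⟩ := hc.window i k
  exact ⟨_, h1, h2, by rwa [hc.per_mul]⟩

@[simp] lemma sg_self (c : ℤ → V) (i : ℤ) : sg c i i = [] := by simp [sg]

@[simp] lemma sg_one (c : ℤ → V) (i : ℤ) : sg c i (i + 1) = [c i] := by simp [sg]

lemma sg_append (c : ℤ → V) {i j k : ℤ} (h1 : i ≤ j) (h2 : j ≤ k) :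
    sg c i j ++ sg c j k = sg c i k := by
  obtain ⟨a, rfl⟩ := Int.le.dest h1
  obtain ⟨b, rfl⟩ := Int.le.dest h2
  have e1 : (i + a - i : ℤ).toNat = a := by omega
  have e2 : (i + a + b - (i + a) : ℤ).toNat = b := by omega
  have e3 : (i + a + b - i : ℤ).toNat = a + b := by omega
  simp only [sg, e1, e2, e3, List.range_add, List.map_append, List.map_map]
  congr 1
  apply List.map_congr_left
  intro k _
  simp [add_assoc]

lemma sg_cons (c : ℤ → V) {i j : ℤ} (h : i < j) : sg c i j = c i :: sg c (i + 1) j := by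
  rw [← sg_append c (show i ≤ i + 1 by omega) (show i + 1 ≤ j by omega)]; simp

lemma sg_concat (c : ℤ → V) {i j : ℤ} (h : i < j) : sg c i j = sg c i (j - 1) ++ [c (j - 1)] := by
  rw [← sg_append c (show i ≤ j - 1 by omega) (show j - 1 ≤ j by omega)]
  congr 1
  simpa using sg_one c (j - 1)

lemma sg_ends (c : ℤ → V) {i j : ℤ} (h : i < j) : Ends (sg c i j) (c i) (c (j - 1)) := by
  refine ⟨by rw [sg_cons c h]; rfl, by rw [sg_concat c h]; simp⟩

lemma Cyc.sg_shift (hc : Cyc A part c n) (i j : ℤ) : sg c (i + n) (j + n) = sg c i j := by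
  simp only [sg, add_sub_add_right_eq_sub]
  apply List.map_congr_left
  intro k _
  rw [← hc.per (i + k)]
  congr 1; ring

lemma Cyc.sg_rotated_zero (hc : Cyc A part c n) (i : ℤ) : sg c 0 n ~r sg c i (i + n) := by
  have key : ∀ i, sg c i (i + n) ~r sg c (i + 1) (i + 1 + n) := by
    intro i
    have hp := hc.pos
    rw [isRotated_iff_append]
    refine ⟨[c i], sg c (i + 1) (i + n), sg_cons c (by omega), ?_⟩
    rw [sg_concat c (by omega), show i + 1 + n - 1 = i + n by ring, hc.per]
  induction i with
  | zero => simpa using List.IsRotated.refl _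
  | succ k ih => exact ih.trans (key _)
  | pred k ih =>
    refine ih.trans ?_
    have := key (-(k : ℤ) - 1)
    rw [show -(k : ℤ) - 1 + 1 = -k by ring] at this
    exact this.symm

lemma Cyc.sg_rotated (hc : Cyc A part c n) (i j : ℤ) : sg c i (i + n) ~r sg c j (j + n) :=
  (hc.sg_rotated_zero i).symm.trans (hc.sg_rotated_zero j)

lemma Cyc.cw_sg (hc : Cyc A part c n) (i : ℤ) : cw w (sg c i (i + n)) = cw w (sg c 0 n) :=
  (cw_rotated (hc.sg_rotated_zero i)).symm

lemma Cyc.pw_sg (hc : Cyc A part c n) (i : ℤ) :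
    pw w (sg c i (i + n)) = cw w (sg c 0 n) - w (c (i - 1)) (c i) := by
  have hp := hc.pos
  rw [← hc.cw_sg i, cw_eq (sg_ends c (show i < i + n by omega)),
    show i + n - 1 = i - 1 + n by ring, hc.per]
  ring

lemma Cyc.cedge (hc : Cyc A part c n) (k i : ℤ) : CEdge (sg c k (k + n)) (c i) (c (i + 1)) := by
  refine CEdge.rotated (l := sg c (i + 1) (i + 1 + n)) (Or.inr ?_) (hc.sg_rotated _ _)
  have := sg_ends c (show i + 1 < i + 1 + n by have := hc.pos; omega)
  rwa [show i + 1 + n - 1 = i + n by ring, hc.per] at this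

/-- The two cycles can not be merged into a single one without losing weight. -/
structure Unm (A : V → V → Prop) (part : V → K) (w : V → V → ℤ) (c : ℤ → V) (n : ℤ)
    (d : ℤ → V) (m : ℤ) : Prop where
  wt : Wt A part w
  left : Cyc A part c n
  right : Cyc A part d m
  irr : ∀ l : List V, l.Perm (sg c 0 n ++ sg d 0 m) →
    cw w l < cw w (sg c 0 n) + cw w (sg d 0 m)

lemma Unm.symm (U : Unm A part w c n d m) : Unm A part w d m c n where
  wt := U.wt
  left := U.right
  right := U.left
  irr l hl := by
    rw [add_comm]
    exact U.irr l (hl.trans List.perm_append_comm)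

lemma Unm.lt (U : Unm A part w c n d m) (i j : ℤ) {l : List V}
    (hl : l.Perm (sg c i (i + n) ++ sg d j (j + m))) :
    cw w l < cw w (sg c 0 n) + cw w (sg d 0 m) :=
  U.irr l (hl.trans
    ((U.left.sg_rotated_zero i).perm.symm.append (U.right.sg_rotated_zero j).perm.symm))

/-- The basic merging inequality. -/
lemma Unm.exchange (U : Unm A part w c n d m) (i j : ℤ) :
    w (c i) (d (j + 1)) + w (d j) (c (i + 1)) < w (c i) (c (i + 1)) + w (d j) (d (j + 1)) := by
  have h1 := sg_ends c (show i + 1 < i + 1 + n by have := U.left.pos; omega)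
  have h2 := sg_ends d (show j + 1 < j + 1 + m by have := U.right.pos; omega)
  have h := U.lt (i + 1) (j + 1) (List.Perm.refl _)
  rw [cw_eq (h1.append h2), pw_append h1 h2, U.left.pw_sg, U.right.pw_sg,
    show i + 1 + n - 1 = i + n by ring, show j + 1 + m - 1 = j + m by ring, U.left.per,
    U.right.per] at h
  simp only [add_sub_cancel_right] at h
  linarith

section Exchange

variable {i i' j j' : ℤ}

lemma Unm.exch (U : Unm A part w c n d m) (hi : i' = i + 1) (hj : j' = j + 1) :
    w (c i) (d j') + w (d j) (c i') < w (c i) (c i') + w (d j) (d j') := by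
  subst hi hj; exact U.exchange i j

lemma Unm.not_both (U : Unm A part w c n d m) (hi : i' = i + 1) (hj : j' = j + 1)
    (h1 : A (c i) (d j')) : ¬ A (d j) (c i') := fun h2 => by
  have h := U.exch hi hj
  rw [U.wt.arc h1, U.wt.arc h2] at h
  linarith [U.wt.le_one (c i) (c i'), U.wt.le_one (d j) (d j')]

lemma Unm.arcs_of_arc_same (U : Unm A part w c n d m) (hi : i' = i + 1) (hj : j' = j + 1)
    (h1 : A (c i) (d j')) (h2 : part (d j) = part (c i')) : A (c i) (c i') ∧ A (d j) (d j') := by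
  have h := U.exch hi hj
  rw [U.wt.arc h1, U.wt.same h2] at h
  rcases U.wt.cases (c i) (c i') with h3 | h3 | h3 <;>
    rcases U.wt.cases (d j) (d j') with h4 | h4 | h4 <;> first | exact ⟨h3.1, h4.1⟩ | omega

lemma Unm.arcs_of_same_arc (U : Unm A part w c n d m) (hi : i' = i + 1) (hj : j' = j + 1)
    (h1 : part (c i) = part (d j')) (h2 : A (d j) (c i')) : A (c i) (c i') ∧ A (d j) (d j') :=
  (U.symm.arcs_of_arc_same hj hi h2 h1).symm

end Exchange

/-- A list which can be split into segments each of which fits into the cycle `c`. -/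
def Cov (w : V → V → ℤ) (c : ℤ → V) (n : ℤ) (l : List V) : Prop :=
  ∃ Ps : List (List V), Ps.flatten = l ∧ ∀ P ∈ Ps, Fits w (sg c 0 n) P

lemma Cov.nil : Cov w c n [] := ⟨[], rfl, by simp⟩

lemma Cov.append {l₁ l₂ : List V} (h₁ : Cov w c n l₁) (h₂ : Cov w c n l₂) :
    Cov w c n (l₁ ++ l₂) := by
  obtain ⟨P, rfl, hP⟩ := h₁
  obtain ⟨Q, rfl, hQ⟩ := h₂
  refine ⟨P ++ Q, by simp, fun X hX => ?_⟩
  rcases List.mem_append.1 hX with h | h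
  exacts [hP X h, hQ X h]

lemma Cov.sg_append {a b e : ℤ} (h₁ : Cov w c n (sg d a b)) (h₂ : Cov w c n (sg d b e))
    (hab : a ≤ b) (hbe : b ≤ e) : Cov w c n (sg d a e) := by
  rw [← GFactor.sg_append d hab hbe]
  exact h₁.append h₂

lemma Cyc.fits (hc : Cyc A part c n) (W : Wt A part w) {P : List V} {a b : V} (hP : Ends P a b)
    {i : ℤ} (h1 : A (c i) a) (h2 : A b (c (i + 1))) : Fits w (sg c 0 n) P :=
  ⟨a, b, c i, c (i + 1), hP, by simpa using hc.cedge 0 i, W.arc h1, W.arc h2⟩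

lemma Cyc.cov (hc : Cyc A part c n) (W : Wt A part w) {a b e i i' : ℤ} (hae : a ≤ e)
    (hb : b = e + 1) (hi : i' = i + 1) (h1 : A (c i) (d a)) (h2 : A (d e) (c i')) :
    Cov w c n (sg d a b) := by
  subst hb hi
  have := sg_ends d (show a < e + 1 by omega)
  rw [add_sub_cancel_right] at this
  exact ⟨[sg d a (e + 1)], by simp, by simpa using hc.fits W this h1 h2⟩

lemma Unm.not_cov (U : Unm A part w c n d m) (j : ℤ) (h : Cov w c n (sg d j (j + m))) :
    False := by
  obtain ⟨Ps, hP, hfit⟩ := h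
  have hne : Ps ≠ [] := by
    rintro rfl
    have := (sg_ends d (show j < j + m by have := U.right.pos; omega)).ne_nil
    simp at hP
    exact this hP
  obtain ⟨l, hl, hcw⟩ := multi_insert U.wt.le_one Ps.length Ps _ le_rfl hne hfit
  rw [hP] at hl hcw
  have h1 := U.lt 0 j (l := l) (by simpa using hl)
  rw [U.right.pw_sg] at hcw
  linarith [U.wt.le_one (d (j - 1)) (d j)]

end Basic

/-! ### Singular vertices -/

/-- `v` receives no arc from the cycle `c`. -/
def OutS (A : V → V → Prop) (c : ℤ → V) (v : V) : Prop := ∀ i, ¬ A (c i) v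

/-- `v` sends no arc to the cycle `c`. -/
def InS (A : V → V → Prop) (c : ℤ → V) (v : V) : Prop := ∀ i, ¬ A v (c i)

/-- `v` can be inserted into the cycle `c`. -/
def Good (A : V → V → Prop) (c : ℤ → V) (v : V) : Prop := ∃ i, A (c i) v ∧ A v (c (i + 1))

section Singular

variable {w : V → V → ℤ} {c d : ℤ → V} {n m : ℤ}

lemma not_outS {v : V} : ¬ OutS A c v ↔ ∃ i, A (c i) v := by simp [OutS]

lemma not_inS {v : V} : ¬ InS A c v ↔ ∃ i, A v (c i) := by simp [InS]

lemma Unm.arc_right (U : Unm A part w c n d m) {j j' : ℤ} (hj : j' = j + 1)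
    (h : part (d j) ≠ part (d j')) : A (d j) (d j') := by
  subst hj; exact (U.right.edge j).resolve_right h

/-- Three vertices in the same partite set, two of them consecutive on the first cycle. -/
lemma Unm.same_same (U : Unm A part w c n d m) {i i' j j₁ j₂ : ℤ} (hi : i' = i + 1)
    (hj₁ : j = j₁ + 1) (hj₂ : j₂ = j + 1) (h1 : part (c i) = part (c i'))
    (h2 : part (c i') = part (d j)) :
    A (d j₂) (c i) ∧ ¬ A (c i) (d j₂) ∧ A (c i') (d j₁) ∧ ¬ A (d j₁) (c i') ∧
      A (d j₁) (d j) ∧ A (d j) (d j₂) := by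
  have e1 := U.exch hi hj₁
  have e2 := U.exch hi hj₂
  have W := U.wt
  rw [W.same h1, W.same (h1.trans h2)] at e1
  rw [W.same h1, W.same h2.symm] at e2
  have n1 := U.right.nonneg W j₁
  have n2 := U.right.nonneg W j
  rw [← hj₁] at n1
  rw [← hj₂] at n2
  have a1 := W.cases (d j₁) (c i')
  have a2 := W.cases (d j₁) (d j)
  have a3 := W.cases (c i) (d j₂)
  have a4 := W.cases (d j) (d j₂)
  have b1 : A (d j₁) (d j) ∧ part (d j₁) ≠ part (d j) ∧ w (d j₁) (d j) = 1 := by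
    rcases a2 with h | h | h
    · exact h
    · rcases a1 with h' | h' | h'
      · omega
      · omega
      · exact absurd (h.2.2.1.trans h2.symm) h'.2.2.1
    · omega
  have b2 : A (d j) (d j₂) ∧ part (d j) ≠ part (d j₂) ∧ w (d j) (d j₂) = 1 := by
    rcases a4 with h | h | h
    · exact h
    · rcases a3 with h' | h' | h'
      · omega
      · omega
      · exact absurd (h1.trans (h2.trans h.2.2.1)) h'.2.2.1
    · omega
  refine ⟨?_, ?_, ?_, ?_, b1.1, b2.1⟩
  · rcases a3 with h' | h' | h'
    · omega
    · exact absurd (h2.symm.trans (h1.symm.trans h'.2.2.1)) b2.2.1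
    · exact h'.2.1
  · intro h
    rw [W.arc h] at e2
    omega
  · rcases a1 with h' | h' | h'
    · omega
    · exact absurd (h'.2.2.1.trans h2) b1.2.1
    · exact h'.2.1
  · intro h
    rw [W.arc h] at e1
    omega

/-- The shape of a non-singular vertex which can not be inserted. -/
lemma Unm.not_good (U : Unm A part w c n d m) {j j₁ j₂ : ℤ} (hj₁ : j = j₁ + 1)
    (hj₂ : j₂ = j + 1) (ho : ¬ OutS A c (d j)) (hi : ¬ InS A c (d j)) (hg : ¬ Good A c (d j)) :
    ∃ i k, A (c i) (d j) ∧ A (d j₂) (c (i + 1)) ∧ part (c (i + 1)) = part (d j) ∧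
      A (d j₁) (d j) ∧ A (d j) (d j₂) ∧ A (d j) (c k) ∧ part (c (k - 1)) = part (d j) := by
  have W := U.wt
  obtain ⟨i₀, hi₀⟩ := not_outS.1 ho
  obtain ⟨k₀, hk₀, -, hk₀'⟩ := U.left.exists_window (not_inS.1 hi) (i₀ + 1)
  have hex : ∃ g : ℕ, ∃ i, A (c i) (d j) ∧ A (d j) (c (i + 1 + g)) :=
    ⟨(k₀ - (i₀ + 1)).toNat, i₀, hi₀, by convert hk₀' using 2; omega⟩
  obtain ⟨i, h1, h2⟩ := Nat.find_spec hex
  set g := Nat.find hex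
  have hmin : ∀ g' < g, ¬ ∃ i, A (c i) (d j) ∧ A (d j) (c (i + 1 + (g' : ℕ))) :=
    fun g' h => Nat.find_min hex h
  have hg0 : g ≠ 0 := fun h0 => hg ⟨i, h1, by simpa [h0] using h2⟩
  have hmid : ∀ t, i < t → t < i + 1 + g → part (c t) = part (d j) := by
    intro t ht1 ht2
    by_contra hp
    rcases W.smd.adj _ _ hp with h | h
    · refine hmin (i + g - t).toNat (by omega) ⟨t, h, ?_⟩
      convert h2 using 2; omega
    · refine hmin (t - i - 1).toNat (by omega) ⟨i, h1, ?_⟩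
      convert h using 2; omega
  have p1 := hmid (i + 1) (by omega) (by omega)
  have p2 := hmid (i + g) (by omega) (by omega)
  have a1 : A (d j₁) (d j) := by
    rw [hj₁] at h1 p1 ⊢
    refine U.arc_right rfl fun hp => ?_
    exact W.ne (U.arcs_of_arc_same rfl rfl h1 (hp.trans p1.symm)).2 hp
  have a2 : A (d j) (d j₂) := by
    refine U.arc_right hj₂ fun hp => ?_
    exact W.ne (U.arcs_of_same_arc (i := i + g) (i' := i + 1 + g) (by ring) hj₂
      (p2.trans hp) h2).2 hp
  refine ⟨i, i + 1 + g, h1, ?_, p1, a1, a2, h2, by rw [← p2]; congr 2; ring⟩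
  by_cases hg1 : g = 1
  · refine W.arc_of_not (fun h => ?_) (fun h => W.ne a2 (p1.symm.trans h))
    exact U.not_both (i := i + 1) (i' := i + 1 + g) (by simp [hg1]) hj₂ h h2
  · have p3 := hmid (i + 2) (by omega) (by omega)
    exact (U.same_same (i := i + 1) (i' := i + 2) (by ring) hj₁ hj₂ (p1.trans p3.symm) p3).1

lemma Unm.cov_or (U : Unm A part w c n d m) : ∀ (g : ℕ) (j₀ j₁ : ℤ), j₁ = j₀ + g →
    (∀ t, j₀ ≤ t → t < j₁ → ¬ OutS A c (d t) ∧ ¬ InS A c (d t)) →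
    Cov w c n (sg d j₀ j₁) ∨
      (j₀ < j₁ ∧ Cov w c n (sg d j₀ (j₁ - 1)) ∧ ¬ Good A c (d (j₁ - 1))) := by
  intro g
  induction g using Nat.strong_induction_on with
  | _ g ih =>
    intro j₀ j₁ hj hns
    rcases Nat.eq_zero_or_pos g with rfl | hg
    · left
      have : j₁ = j₀ := by simpa using hj
      rw [this, sg_self]
      exact Cov.nil
    have hstep : ∀ s : ℕ, 0 < s → s ≤ g → Cov w c n (sg d j₀ (j₀ + s)) →
        Cov w c n (sg d j₀ j₁) ∨
          (j₀ < j₁ ∧ Cov w c n (sg d j₀ (j₁ - 1)) ∧ ¬ Good A c (d (j₁ - 1))) := by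
      intro s hs hsg hcov
      rcases ih (g - s) (by omega) (j₀ + s) j₁ (by omega)
        (fun t h1 h2 => hns t (by omega) h2) with h | ⟨h1, h2, h3⟩
      · exact Or.inl (hcov.sg_append h (by omega) (by omega))
      · exact Or.inr ⟨by omega, hcov.sg_append h2 (by omega) (by omega), h3⟩
    by_cases hgood : Good A c (d j₀)
    · obtain ⟨i, h1, h2⟩ := hgood
      exact hstep 1 one_pos hg (U.left.cov U.wt le_rfl (by simp) rfl h1 h2)
    · rcases eq_or_ne g 1 with rfl | hg1
      · right
        have : j₁ - 1 = j₀ := by simp [hj]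
        rw [this, sg_self]
        exact ⟨by omega, Cov.nil, hgood⟩
      · obtain ⟨ho, hi⟩ := hns j₀ le_rfl (by omega)
        obtain ⟨i, -, h1, h2, -⟩ := U.not_good (j₁ := j₀ - 1) (by ring) rfl ho hi hgood
        exact hstep 2 two_pos (by omega)
          (U.left.cov U.wt (e := j₀ + 1) (by omega) (by push_cast; ring) rfl h1 h2)

lemma Unm.cov (U : Unm A part w c n d m) {j₀ j₁ : ℤ} (hj : j₀ ≤ j₁)
    (hns : ∀ t, j₀ ≤ t → t < j₁ → ¬ OutS A c (d t) ∧ ¬ InS A c (d t))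
    (hlast : j₀ < j₁ → Good A c (d (j₁ - 1))) : Cov w c n (sg d j₀ j₁) := by
  rcases U.cov_or (j₁ - j₀).toNat j₀ j₁ (by omega) hns with h | ⟨h1, -, h2⟩
  · exact h
  · exact absurd (hlast h1) h2

end Singular

section NoSingular

variable {w : V → V → ℤ} {c d : ℤ → V} {n m : ℤ}

lemma Cyc.forall_of_step (hc : Cyc A part c n) {p : V → Prop} (h : ∃ i, p (c i))
    (step : ∀ i, p (c i) → p (c (i + 1))) (i : ℤ) : p (c i) := by
  obtain ⟨k, -, hk, hp⟩ := hc.exists_window h (i - n + 1)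
  have : ∀ g : ℕ, p (c (k + g)) := by
    intro g
    induction g with
    | zero => simpa using hp
    | succ g ih => simpa [add_assoc] using step _ ih
  convert this (i - k).toNat using 2
  omega

lemma Cyc.forall_of_step_back (hc : Cyc A part c n) {p : V → Prop} (h : ∃ i, p (c i))
    (step : ∀ i, p (c (i + 1)) → p (c i)) (i : ℤ) : p (c i) := by
  obtain ⟨k, hk⟩ := h
  by_contra hi
  exact hc.forall_of_step (p := fun v => ¬ p v) ⟨i, hi⟩ (fun i => mt (step i)) k hk

lemma Unm.not_good_of_forall (U : Unm A part w c n d m)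
    (hns : ∀ j, ¬ OutS A c (d j) ∧ ¬ InS A c (d j)) (t : ℤ) : ¬ Good A c (d t) := by
  intro h
  have hm := U.right.pos
  refine U.not_cov (t + 1) (U.cov (by omega) (fun t _ _ => hns t) fun _ => ?_)
  rwa [show t + 1 + m - 1 = t + m by ring, U.right.per]

lemma Unm.cov_even (U : Unm A part w c n d m)
    (hns : ∀ j, ¬ OutS A c (d j) ∧ ¬ InS A c (d j)) (g : ℕ) (j : ℤ) :
    Cov w c n (sg d j (j + 2 * g)) := by
  induction g with
  | zero => simpa using Cov.nil
  | succ g ih =>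
    refine ih.sg_append ?_ (by omega) (by omega)
    obtain ⟨i, -, h1, h2, -⟩ := U.not_good (j := j + 2 * g) (j₁ := j + 2 * g - 1) (by ring) rfl
      (hns _).1 (hns _).2 (U.not_good_of_forall hns _)
    exact U.left.cov U.wt (e := j + 2 * g + 1) (by omega) (by push_cast; ring) rfl h1 h2

/-- Some vertex of the second cycle is singular with respect to the first one. -/
theorem Unm.exists_singular (U : Unm A part w c n d m) :
    ∃ j, OutS A c (d j) ∨ InS A c (d j) := by
  by_contra! hns
  have W := U.wt
  have hm := U.right.pos
  have hbad := U.not_good_of_forall hns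
  rcases Int.even_or_odd' m with ⟨g, hg | hg⟩
  · refine U.not_cov 0 ?_
    convert U.cov_even hns g.toNat 0 using 2
    omega
  have R : ∀ i j (k : ℤ), 0 ≤ k → 2 * k < m → A (c i) (d j) → ¬ A (d (j + 2 * k)) (c (i + 1)) := by
    intro i j k hk0 hk h1 h2
    refine U.not_cov j (Cov.sg_append
      (U.left.cov U.wt (e := j + 2 * k) (by omega) rfl rfl h1 h2) ?_ (by omega) (by omega))
    convert U.cov_even hns (g - k).toNat (j + 2 * k + 1) using 2
    omega
  have R0 : ∀ i j, A (c i) (d j) → ¬ A (d j) (c (i + 1)) := by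
    intro i j h
    simpa using R i j 0 le_rfl (by simpa using hm) h
  have darc : ∀ j, A (d j) (d (j + 1)) := by
    intro j
    obtain ⟨i, k, -, -, -, -, h, -⟩ := U.not_good (j := j) (j₁ := j - 1) (by ring) rfl
      (hns _).1 (hns _).2 (hbad _)
    exact h
  have darc' : ∀ j, A (d (j - 1)) (d j) := fun j => by simpa using darc (j - 1)
  have hm1 : m ≠ 1 := by
    rintro rfl
    exact W.ne (darc 0) (by rw [U.right.per])
  have S : ∀ i, ∃ t, A (c i) (d t) := by
    refine fun i => U.left.forall_of_step (p := fun v => ∃ t, A v (d t)) ?_ ?_ i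
    · obtain ⟨i, hi⟩ := not_outS.1 (hns 0).1
      exact ⟨i, 0, hi⟩
    · rintro i ⟨j, hj⟩
      by_contra! hcon
      have h1 : part (d j) = part (c (i + 1)) := by
        by_contra hp
        exact hcon _ (W.arc_of_not (R0 i j hj) hp)
      have h2 : part (d (j - 1)) = part (c (i + 1)) := by
        by_contra hp
        exact hcon _ (W.arc_of_not (U.not_both rfl (by ring) hj) hp)
      exact W.ne (darc' j) (h2.trans h1.symm)
  have T : ∀ i, ∃ t, A (d t) (c i) := by
    refine fun i => U.left.forall_of_step_back (p := fun v => ∃ t, A (d t) v) ?_ ?_ i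
    · obtain ⟨i, hi⟩ := not_inS.1 (hns 0).2
      exact ⟨i, 0, hi⟩
    · rintro i ⟨j, hj⟩
      by_contra! hcon
      have h1 : part (c i) = part (d j) := by
        by_contra hp
        exact hcon _ (W.arc_of_not (fun h => R0 i j h hj) hp)
      have h2 : part (c i) = part (d (j + 1)) := by
        by_contra hp
        exact hcon _ (W.arc_of_not (fun h => U.not_both rfl rfl h hj) hp)
      exact W.ne (darc j) (h1.symm.trans h2)
  have hns' : ∀ i, ¬ OutS A d (c i) ∧ ¬ InS A d (c i) :=
    fun i => ⟨not_outS.2 (T i), not_inS.2 (S i)⟩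
  have cbad := U.symm.not_good_of_forall hns'
  have carc : ∀ i, A (c i) (c (i + 1)) := by
    intro j
    obtain ⟨i, k, -, -, -, -, h, -⟩ := U.symm.not_good (j := j) (j₁ := j - 1) (by ring) rfl
      (hns' _).1 (hns' _).2 (cbad _)
    exact h
  have NN : ∀ i j, A (c i) (d j) → ¬ A (c i) (d (j + 1)) := by
    intro i j h1 h2
    obtain ⟨t, ht1, ht2, ht⟩ := U.right.exists_window (p := fun v => A v (c (i + 1))) (T (i + 1)) j
    rcases Int.even_or_odd' (t - j) with ⟨k, hk | hk⟩
    · refine R i j k (by omega) (by omega) h1 ?_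
      rwa [← hk, add_sub_cancel]
    · refine R i (j + 1) k (by omega) (by omega) h2 ?_
      rwa [show j + 1 + 2 * k = t by omega]
  have MM : ∀ i j, A (d j) (c i) → ¬ A (d (j + 1)) (c i) := by
    intro i j h1 h2
    obtain ⟨t, ht1, ht2, ht⟩ := U.right.exists_window (S (i - 1)) (j - m + 1)
    rcases Int.even_or_odd' (j - t) with ⟨k, hk | hk⟩
    · refine R (i - 1) t k (by omega) (by omega) ht ?_
      rwa [show t + 2 * k = j by omega, sub_add_cancel]
    · refine R (i - 1) t (k + 1) (by omega) (by omega) ht ?_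
      rwa [show t + 2 * (k + 1) = j + 1 by omega, sub_add_cancel]
  have G : ∀ i j, A (d j) (c i) → ¬ A (c i) (d (j + 1)) := fun i j h1 h2 => cbad i ⟨j, h1, h2⟩
  obtain ⟨p, hp1, hp2⟩ : ∃ p, A (c 0) (d p) ∧ A (d (p + 1)) (c 0) := by
    by_contra! hcon
    have flip : ∀ t, part (d (t + 1)) = part (c 0) ↔ ¬ part (d t) = part (c 0) := by
      intro t
      refine ⟨fun h1 h2 => W.ne (darc t) (h2.trans h1.symm), fun h1 => ?_⟩
      by_contra h2
      rcases W.smd.adj _ _ h1 with h | h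
      · rcases W.smd.adj _ _ h2 with h' | h'
        · exact MM _ _ h h'
        · exact G _ _ h h'
      · rcases W.smd.adj _ _ h2 with h' | h'
        · exact hcon _ h h'
        · exact NN _ _ h h'
    have ev : ∀ (g : ℕ), part (d (0 + 2 * g)) = part (c 0) ↔ part (d 0) = part (c 0) := by
      intro g
      induction g with
      | zero => simp
      | succ g ih =>
        rw [← ih, show (0 : ℤ) + 2 * (g + 1 : ℕ) = 0 + 2 * g + 1 + 1 by push_cast; ring, flip, flip,
          not_not]
    have h1 := ev g.toNat
    have h2 := flip (0 + 2 * g.toNat)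
    rw [show 0 + 2 * (g.toNat : ℤ) + 1 = 0 + m by omega, U.right.per] at h2
    tauto
  have q1 : part (d (p - 1)) = part (c 0) := by
    by_contra h
    rcases W.smd.adj _ _ h with h | h
    · exact G 0 (p - 1) h (by simpa using hp1)
    · exact NN 0 (p - 1) h (by simpa using hp1)
  have q2 : part (d (p + 1 + 1)) = part (c 0) := by
    by_contra h
    rcases W.smd.adj _ _ h with h | h
    · exact MM 0 _ hp2 h
    · exact G 0 _ hp2 h
  have r1 : A (c (0 + 1)) (d (p - 1)) :=
    W.arc_of_not (U.not_both rfl (by ring) hp1) fun h => W.ne (carc 0) (q1.symm.trans h)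
  have r2 : A (c (0 + 1)) (d (p + 1 + 1)) := by
    refine W.arc_of_not ?_ fun h => W.ne (carc 0) (q2.symm.trans h)
    rw [show p + 1 + 1 = p + 2 * 1 by ring]
    exact R 0 p 1 (by omega) (by omega) hp1
  have r3 : part (d p) = part (c (0 + 1)) := by
    by_contra h
    exact NN (0 + 1) (p - 1) r1 (by simpa using W.arc_of_not (R0 0 p hp1) h)
  have r4 : A (d (p + 1)) (c (0 + 1)) :=
    W.arc_of_not (fun h => NN _ _ h r2) fun h => W.ne (darc p) (r3.trans h)
  exact G _ _ r4 r2

end NoSingular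

section Pairs

variable {w : V → V → ℤ} {c d : ℤ → V} {n m : ℤ}

/-- A cycle contained in a partite set met by the other cycle can be merged with it. -/
lemma Unm.not_forall_part (U : Unm A part w c n d m) (j : ℤ) :
    ¬ ∀ i, part (c i) = part (d j) := by
  intro h
  have Z := fun i : ℤ => U.same_same (i := i) (i' := i + 1) (j := j) (j₁ := j - 1) rfl (by ring) rfl
    ((h _).trans (h _).symm) (h _)
  obtain ⟨i, hi | hi⟩ := U.symm.exists_singular
  · exact hi _ (Z i).1
  · exact hi (j - 1) (by simpa using (Z (i - 1)).2.2.1)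

lemma Cyc.forall_part (hc : Cyc A part c n) {P Q : K} (hPQ : P ≠ Q)
    (h : ∀ i, part (c i) = P ∨ part (c (i + 1)) = Q) :
    (∀ i, part (c i) = P) ∨ ∀ i, part (c i) = Q := by
  by_contra! hcon
  obtain ⟨hP, k, hk⟩ := hcon
  have := hc.forall_of_step (p := fun v => part v ≠ P) hP
    (fun i hi => by rw [(h i).resolve_left hi]; exact hPQ.symm) (k - 1)
  have h2 := (h (k - 1)).resolve_left this
  rw [sub_add_cancel] at h2
  exact hk h2

lemma Unm.not_edges_part (U : Unm A part w c n d m) {j j' : ℤ} (hne : part (d j) ≠ part (d j'))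
    (h : ∀ i, part (c i) = part (d j) ∨ part (c (i + 1)) = part (d j')) : False := by
  rcases U.left.forall_part hne h with h | h
  · exact U.not_forall_part _ h
  · exact U.not_forall_part _ h

lemma OutS.arc {v : V} (h : OutS A c v) (W : Wt A part w) {i : ℤ} (hp : part (c i) ≠ part v) :
    A v (c i) := W.arc_of_not (h i) hp

lemma InS.arc {v : V} (h : InS A c v) (W : Wt A part w) {i : ℤ} (hp : part (c i) ≠ part v) :
    A (c i) v := W.arc_of_not (h i) hp.symm

/-- The singular vertices of one cycle with respect to the other are all of the same kind. -/
theorem Unm.not_outS_inS (U : Unm A part w c n d m) {j₀' j₁' : ℤ} (ho : OutS A c (d j₀'))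
    (hi : InS A c (d j₁')) : False := by
  have W := U.wt
  have hm := U.right.pos
  obtain ⟨k₀, hk₀, hkm, hk₀'⟩ := U.right.exists_window (p := InS A c) ⟨_, hi⟩ (j₀' + 1)
  have hex : ∃ g : ℕ, ∃ j, OutS A c (d j) ∧ InS A c (d (j + 1 + g)) :=
    ⟨(k₀ - (j₀' + 1)).toNat, j₀', ho, by convert hk₀' using 2; omega⟩
  obtain ⟨j₀, ho, hi⟩ := Nat.find_spec hex
  have hmin : ∀ g' < Nat.find hex, ¬ ∃ j, OutS A c (d j) ∧ InS A c (d (j + 1 + (g' : ℕ))) :=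
    fun g' h => Nat.find_min hex h
  have hle : Nat.find hex ≤ (k₀ - (j₀' + 1)).toNat :=
    Nat.find_le ⟨j₀', ‹_›, by convert hk₀' using 2; omega⟩
  obtain ⟨j₁, hj₁⟩ : ∃ j₁, j₁ = j₀ + 1 + (Nat.find hex : ℤ) := ⟨_, rfl⟩
  rw [← hj₁] at hi
  have hns : ∀ t, j₀ + 1 ≤ t → t < j₁ → ¬ OutS A c (d t) ∧ ¬ InS A c (d t) := by
    intro t h1 h2
    refine ⟨fun h => hmin (j₁ - t - 1).toNat (by omega) ⟨t, h, ?_⟩,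
      fun h => hmin (t - j₀ - 1).toNat (by omega) ⟨j₀, ho, ?_⟩⟩
    · convert hi using 2; omega
    · convert h using 2; omega
  have hjm : j₁ ≤ j₀ + m := by omega
  have hlt : j₀ < j₁ := by omega
  clear hmin hle hj₁ hex
  have ho' : ∀ {i}, part (c i) ≠ part (d j₀) → A (d (j₀ + m)) (c i) := fun h => by
    rw [U.right.per]; exact ho.arc W h
  by_cases h1 : ∃ i, part (c i) ≠ part (d j₁) ∧ part (c (i + 1)) ≠ part (d j₀)
  · obtain ⟨i, hi1, hi0⟩ := h1
    refine U.not_cov (j₀ + 1) (Cov.sg_append (b := j₁) ?_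
      (U.left.cov W hjm (by ring) rfl (hi.arc W hi1) (ho' hi0)) (by omega) (by omega))
    refine U.cov (by omega) hns fun h => ?_
    by_contra hg
    obtain ⟨i, -, -, h', -⟩ := U.not_good (j₁ := j₁ - 1 - 1) (j₂ := j₁) (by ring) (by ring)
      (hns _ (by omega) (by omega)).1 (hns _ (by omega) (by omega)).2 hg
    exact hi _ h'
  have hVV : ∀ i, part (c i) = part (d j₁) ∨ part (c (i + 1)) = part (d j₀) := by
    intro i
    by_contra! hcon
    exact h1 ⟨i, hcon⟩
  by_cases hp : part (d j₁) = part (d j₀)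
  swap
  · exact U.not_edges_part hp hVV
  simp only [← hp] at hVV ho'
  have F1 : ∀ i, part (c i) ≠ part (d j₁) →
      A (c (i + 1)) (d (j₁ - 1)) ∧ ¬ A (d (j₁ - 1)) (c (i + 1)) := by
    intro i hci
    have a1 := hi.arc W hci
    have a2 := (hVV i).resolve_left hci
    have a3 := U.not_both (i := i) (j := j₁ - 1) rfl (by ring) a1
    refine ⟨W.arc_of_not a3 fun h => ?_, a3⟩
    exact W.ne (U.arcs_of_arc_same rfl (by ring) a1 h).2 (h.trans a2)
  have F2 : ∀ i, part (c (i + 1)) = part (d j₁) →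
      A (c (i + 1)) (d (j₁ - 1)) ∧ ¬ A (d (j₁ - 1)) (c (i + 1)) := by
    intro i hci
    by_cases h : part (c i) = part (d j₁)
    · have := U.same_same (i := i) (i' := i + 1) (j := j₁) (j₁ := j₁ - 1) rfl (by ring) rfl
        (h.trans hci.symm) hci
      exact ⟨this.2.2.1, this.2.2.2.1⟩
    · exact F1 i h
  obtain ⟨i, hci⟩ : ∃ i, part (c i) ≠ part (d j₁) := by
    by_contra! hcon
    exact U.not_forall_part _ hcon
  have b1 : A (c (i - 1)) (d (j₁ - 1)) := by
    have h2 := hVV (i - 1)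
    rw [sub_add_cancel] at h2
    have := (F2 (i - 1 - 1) (by rw [sub_add_cancel]; exact h2.resolve_right hci)).1
    rwa [sub_add_cancel] at this
  have hj : j₁ - 1 ≠ j₀ := fun h => ho (i - 1) (by rwa [h] at b1)
  have seg : Cov w c n (sg d (j₁ - 1) (j₀ + 1 + m)) :=
    U.left.cov W (by omega) (by ring) (by ring) b1 (ho' hci)
  rcases U.cov_or (j₁ - 1 - (j₀ + 1)).toNat (j₀ + 1) (j₁ - 1) (by omega)
    (fun t h1 h2 => hns t h1 (by omega)) with h | ⟨h1, h2, h3⟩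
  · exact U.not_cov (j₀ + 1) (h.sg_append seg (by omega) (by omega))
  · obtain ⟨i', -, e1, e2, -⟩ := U.not_good (j₁ := j₁ - 1 - 1 - 1) (j₂ := j₁ - 1) (by ring)
      (by ring) (hns _ (by omega) (by omega)).1 (hns _ (by omega) (by omega)).2 h3
    by_cases hV : part (c (i' + 1)) = part (d j₁)
    · exact (F2 i' hV).2 e2
    · exact U.not_cov (j₀ + 1) (h2.sg_append
        (U.left.cov W (by omega) (by ring) rfl e1 (ho' hV)) (by omega) (by omega))

/-- Two cycles can not both have in-singular vertices. -/
lemma Unm.not_inS_inS (U : Unm A part w c n d m) {i j : ℤ} (hj : InS A c (d j))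
    (hi : InS A d (c i)) : False := by
  have W := U.wt
  have hp : part (c i) = part (d j) := by
    by_contra hp
    exact hi j (hj.arc W hp)
  have key : ∀ {c d : ℤ → V} {n m : ℤ}, Unm A part w c n d m → ∀ {i j : ℤ}, InS A c (d j) →
      InS A d (c i) → part (c i) = part (d j) → part (c (i - 1)) ≠ part (c i) := by
    intro c d n m U i j hj hi hp h
    exact hi _ (U.same_same (i := i - 1) (i' := i) (j := j) (j₁ := j - 1) (by ring) (by ring) rfl
      h hp).2.2.1
  exact U.not_both (i := i - 1) (j := j - 1) (by ring) (by ring)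
    (hj.arc W (hp ▸ key U hj hi hp)) (hi.arc W (hp.symm ▸ key U.symm hi hj hp.symm))

/-- Two cycles can not both have out-singular vertices. -/
lemma Unm.not_outS_outS (U : Unm A part w c n d m) {i j : ℤ} (hj : OutS A c (d j))
    (hi : OutS A d (c i)) : False := by
  have W := U.wt
  have hp : part (c i) = part (d j) := by
    by_contra hp
    exact hj i (hi.arc W (Ne.symm hp))
  have key : ∀ {c d : ℤ → V} {n m : ℤ}, Unm A part w c n d m → ∀ {i j : ℤ}, OutS A c (d j) →
      OutS A d (c i) → part (c i) = part (d j) → part (c (i + 1)) ≠ part (c i) := by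
    intro c d n m U i j hj hi hp h
    exact hi _ (U.same_same (i := i) (i' := i + 1) (j := j) (j₁ := j - 1) rfl (by ring) rfl
      h.symm (h.trans hp)).1
  exact U.not_both (i := i) (j := j) rfl rfl
    (hi.arc W (hp.symm ▸ key U.symm hi hj hp.symm)) (hj.arc W (hp ▸ key U hj hi hp))

/-- The cycle `c` precedes the cycle `d`. -/
def Gt (A : V → V → Prop) (c d : ℤ → V) : Prop :=
  (∃ i, OutS A d (c i)) ∧ (∀ i, ¬ InS A d (c i)) ∧ (∃ j, InS A c (d j)) ∧ ∀ j, ¬ OutS A c (d j)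

theorem Unm.gt_or_gt (U : Unm A part w c n d m) : Gt A c d ∨ Gt A d c := by
  obtain ⟨j, hj | hj⟩ := U.exists_singular <;> obtain ⟨i, hi | hi⟩ := U.symm.exists_singular
  · exact (U.not_outS_outS hj hi).elim
  · exact Or.inr ⟨⟨j, hj⟩, fun _ h => U.not_outS_inS hj h, ⟨i, hi⟩,
      fun _ h => U.symm.not_outS_inS h hi⟩
  · exact Or.inl ⟨⟨i, hi⟩, fun _ h => U.symm.not_outS_inS hi h, ⟨j, hj⟩,
      fun _ h => U.not_outS_inS h hj⟩
  · exact (U.not_inS_inS hj hi).elim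

end Pairs

section BackArcs

variable {w : V → V → ℤ} {c d : ℤ → V} {n m : ℤ}

lemma Unm.part_pred_of_back (U : Unm A part w c n d m) (hg : Gt A c d) {i j i₁ j' : ℤ}
    (h : A (d j) (c i)) (hi : i = i₁ + 1) (h1 : j < j') (h2 : j' ≤ j + m)
    (h3 : ∀ t, j < t → t < j' → ¬ InS A c (d t)) (h4 : InS A c (d j')) :
    part (c i₁) = part (d j') := by
  by_contra hp
  have W := U.wt
  have hns : ∀ t, j + 1 ≤ t → t < j' → ¬ OutS A c (d t) ∧ ¬ InS A c (d t) :=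
    fun t ht1 ht2 => ⟨hg.2.2.2 t, h3 t (by omega) ht2⟩
  refine U.not_cov (j + 1) (Cov.sg_append (b := j') (U.cov (by omega) hns fun hlt => ?_)
    (U.left.cov W (e := j + m) h2 (by ring) hi (h4.arc W hp) (by rwa [U.right.per]))
    (by omega) (by omega))
  by_contra hgood
  obtain ⟨k, -, -, h', -⟩ := U.not_good (j₁ := j' - 1 - 1) (j₂ := j') (by ring) (by ring)
    (hns _ (by omega) (by omega)).1 (hns _ (by omega) (by omega)).2 hgood
  exact h4 _ h'

lemma Unm.part_succ_of_back (U : Unm A part w c n d m) (hg : Gt A c d) (g : ℕ) :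
    ∀ {i j j' : ℤ}, A (d j) (c i) → j' = j + g → j < j' → j' ≤ j + m →
    (∀ t, j < t → t < j' → ¬ InS A c (d t)) → InS A c (d j') →
    part (c (i - 1)) = part (d (j + 1)) := by
  induction g with
  | zero => intro i j j' _ h1 h2; omega
  | succ g ih =>
    intro i j j' h e h1 h2 h3 h4
    have W := U.wt
    by_contra hp
    have hb := W.arc_of_not (fun h' => U.not_both (i := i - 1) (i' := i) (by ring) rfl h' h) hp
    have hne : j' ≠ j + 1 := by rintro rfl; exact h4 _ hb
    have e1 := ih hb (by push_cast at e; omega) (by omega) (by omega)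
      (fun t ht1 ht2 => h3 t (by omega) ht2) h4
    have e2 := U.part_pred_of_back hg (i₁ := i - 1 - 1) hb (by ring) (by omega) (by omega)
      (fun t ht1 ht2 => h3 t (by omega) ht2) h4
    have e3 := U.part_pred_of_back hg (i₁ := i - 1) h (by ring) h1 h2 h3 h4
    have := U.same_same (i := i - 1 - 1) (i' := i - 1) (j := j + 1 + 1) (j₁ := j + 1)
      (by ring) (by ring) rfl (e2.trans e3.symm) (e3.trans (e2.symm.trans e1))
    exact this.2.2.2.1 hb

/-- The structure around an arc going back from the later cycle to the earlier one. -/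
lemma Unm.back_arc (U : Unm A part w c n d m) (hg : Gt A c d) {i i₁ j j₂ : ℤ}
    (h : A (d j) (c i)) (hi : i = i₁ + 1) (hj : j₂ = j + 1) :
    A (c i₁) (c i) ∧ A (d j) (d j₂) ∧ part (c i₁) = part (d j₂) ∧
      ∃ j', InS A c (d j') ∧ A (d (j' - 1)) (d j') ∧ part (d j') = part (c i₁) := by
  obtain rfl : i₁ = i - 1 := by omega
  subst hj
  have W := U.wt
  obtain ⟨k, hk1, hk2, hk⟩ := U.right.exists_window (p := InS A c) hg.2.2.1 (j + 1)
  obtain ⟨j', ⟨hj1, hj⟩, hmin⟩ := Int.exists_least_of_bdd (P := fun t => j < t ∧ InS A c (d t))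
    ⟨j, fun z hz => hz.1.le⟩ ⟨k, by omega, hk⟩
  have hle := hmin k ⟨by omega, hk⟩
  have h3 : ∀ t, j < t → t < j' → ¬ InS A c (d t) :=
    fun t ht1 ht2 h => absurd (hmin t ⟨ht1, h⟩) (by omega)
  have e1 := U.part_succ_of_back hg (j' - j).toNat h (by omega) hj1 (by omega) h3 hj
  have e2 := U.arcs_of_same_arc (i := i - 1) (i' := i) (by ring) rfl e1 h
  refine ⟨e2.1, e2.2, e1, j', hj, ?_,
    (U.part_pred_of_back hg (i₁ := i - 1) h (by ring) hj1 (by omega) h3 hj).symm⟩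
  rcases eq_or_ne j' (j + 1) with rfl | hne
  · simpa using e2.2
  · obtain ⟨k, hk⟩ := not_inS.1 (h3 (j' - 1) (by omega) (by omega))
    have e3 := U.part_succ_of_back hg 1 hk (j' := j') (by simp) (by omega)
      (by have := U.right.pos; omega) (fun t _ _ => by omega) hj
    exact (U.arcs_of_same_arc (i := k - 1) (i' := k) (j' := j') (by ring) (by ring)
      (by rwa [sub_add_cancel] at e3) hk).2

lemma Unm.good_left (U : Unm A part w c n d m) (hg : Gt A c d) {t : ℤ}
    (h : ¬ OutS A d (c t)) : Good A d (c t) := by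
  by_contra hgood
  obtain ⟨i, -, h1, h2, h3, h4, -⟩ :=
    U.symm.not_good (j₁ := t - 1) (j₂ := t + 1) (by ring) rfl h (hg.2.1 t) hgood
  have := (U.back_arc hg (i₁ := t - 1) h1 (by ring) rfl).2.2.1
  exact U.wt.ne h4 (this.trans h3)

lemma Unm.good_right (U : Unm A part w c n d m) (hg : Gt A c d) {t : ℤ}
    (h : ¬ InS A c (d t)) : Good A c (d t) := by
  by_contra hgood
  obtain ⟨-, k, -, -, -, -, h4, h5, h6⟩ :=
    U.not_good (j₁ := t - 1) (j₂ := t + 1) (by ring) rfl (hg.2.2.2 t) h hgood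
  have := (U.back_arc hg (i₁ := k - 1) h5 (by ring) rfl).2.2.1
  exact U.wt.ne h4 (h6.symm.trans this)

end BackArcs

/-! ### Cyclic triples -/

/-- Three cycles which precede each other cyclically and can not be merged. -/
structure Tri (A : V → V → Prop) (part : V → K) (w : V → V → ℤ) (a : ℤ → V) (na : ℤ)
    (b : ℤ → V) (nb : ℤ) (c : ℤ → V) (nc : ℤ) : Prop where
  ab : Unm A part w a na b nb
  bc : Unm A part w b nb c nc
  ca : Unm A part w c nc a na
  gab : Gt A a b
  gbc : Gt A b c
  gca : Gt A c a
  irr : ∀ l : List V, l.Perm (sg a 0 na ++ (sg b 0 nb ++ sg c 0 nc)) →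
    cw w l < cw w (sg a 0 na) + cw w (sg b 0 nb) + cw w (sg c 0 nc)

section Triples

variable {w : V → V → ℤ} {a b c : ℤ → V} {na nb nc : ℤ}

lemma Tri.rotate (T : Tri A part w a na b nb c nc) : Tri A part w b nb c nc a na where
  ab := T.bc
  bc := T.ca
  ca := T.ab
  gab := T.gbc
  gbc := T.gca
  gca := T.gab
  irr l hl := by
    have := T.irr l (hl.trans (by
      rw [← List.append_assoc]
      exact List.perm_append_comm))
    linarith

/-- Inserting the cycle `a` into a path through the other two cycles. -/
lemma Tri.link (T : Tri A part w a na b nb c nc) {W : List V} {s e : V} {i₀ i₁ : ℤ}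
    (hW : W.Perm (sg b 0 nb ++ sg c 0 nc))
    (hpw : cw w (sg b 0 nb) + cw w (sg c 0 nc) - 1 ≤ pw w W) (hE : Ends W s e)
    (hi : i₀ < i₁) (hin : i₁ ≤ i₀ + na) (h₀ : A (a i₀) s) (h₁ : A e (a i₁))
    (hmid : ∀ t, i₀ < t → t < i₁ →
      A (a t) s ∨ A e (a t) ∨ ∃ p q, Adj W p q ∧ A p (a t) ∧ A (a t) q) : False := by
  have hwt := T.ab.wt
  have hc := T.ab.left
  obtain ⟨J, ⟨hJ1, hJ2, hJ⟩, hJmax⟩ := Int.exists_greatest_of_bdd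
    (P := fun t => i₀ ≤ t ∧ t < i₁ ∧ A (a t) s) ⟨i₁, fun z hz => hz.2.1.le⟩ ⟨i₀, le_rfl, hi, h₀⟩
  obtain ⟨M, ⟨hM1, hM2, hM⟩, hMmin⟩ := Int.exists_least_of_bdd
    (P := fun t => J < t ∧ t ≤ i₁ ∧ A e (a t)) ⟨J, fun z hz => hz.1.le⟩ ⟨i₁, hJ2, le_rfl, h₁⟩
  have hmid' : ∀ t, J < t → t < M → ∃ p q, Adj W p q ∧ A p (a t) ∧ A (a t) q := by
    intro t ht1 ht2
    rcases hmid t (by omega) (by omega) with h | h | h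
    · exact absurd (hJmax t ⟨by omega, by omega, h⟩) (by omega)
    · exact absurd (hMmin t ⟨by omega, by omega, h⟩) (by omega)
    · exact h
  have hL := sg_ends a (show M < J + 1 + na by omega)
  rw [show J + 1 + na - 1 = J + na by ring, hc.per] at hL
  have hcw : cw w (W ++ sg a M (J + 1 + na)) = pw w W + pw w (sg a M (J + 1 + na)) + 2 := by
    rw [cw_eq (hE.append hL), pw_append hE hL, hwt.arc hM, hwt.arc hJ]
    ring
  have hperm : ∀ l : List V, l.Perm (W ++ sg a M (J + 1 + na) ++ sg a (J + 1) M) →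
      cw w l < cw w (sg a 0 na) + cw w (sg b 0 nb) + cw w (sg c 0 nc) := by
    intro l hl
    refine T.irr l (hl.trans ?_)
    rw [List.append_assoc]
    refine List.perm_append_comm.trans (List.Perm.append ?_ hW)
    refine List.perm_append_comm.trans ?_
    rw [sg_append a (by omega) (by omega)]
    exact (hc.sg_rotated_zero (J + 1)).perm.symm
  have hfull := hc.pw_sg (w := w) (J + 1)
  rw [add_sub_cancel_right] at hfull
  have hle1 := hwt.le_one (a J) (a (J + 1))
  rcases eq_or_ne M (J + 1) with hMJ | hMJ
  · have := hperm (W ++ sg a M (J + 1 + na)) (by rw [hMJ, sg_self]; simp)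
    rw [hMJ] at hcw this
    omega
  · have hmid_ends := sg_ends a (show J + 1 < M by omega)
    rw [← sg_append a (show J + 1 ≤ M by omega) (by omega), pw_append hmid_ends hL] at hfull
    have hle2 := hwt.le_one (a (M - 1)) (a M)
    have hflat : ((sg a (J + 1) M).map fun v => [v]).flatten = sg a (J + 1) M := by
      generalize sg a (J + 1) M = l
      induction l with
      | nil => rfl
      | cons x l ih => simp [ih]
    obtain ⟨l, hl1, hl2⟩ := multi_insert hwt.le_one _ ((sg a (J + 1) M).map fun v => [v])
      (W ++ sg a M (J + 1 + na)) le_rfl (by simpa using hmid_ends.ne_nil) (by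
      intro P hP
      obtain ⟨v, hv, rfl⟩ := List.mem_map.1 hP
      simp only [sg, List.mem_map, List.mem_range] at hv
      obtain ⟨k, hk, rfl⟩ := hv
      obtain ⟨p, q, hpq, h1, h2⟩ := hmid' (J + 1 + k) (by omega) (by omega)
      exact ⟨_, _, p, q, ends_singleton _, Or.inl (hpq.append_right _), hwt.arc h1, hwt.arc h2⟩)
    rw [hflat] at hl1 hl2
    have := hperm l hl1
    omega

lemma Tri.edge_cases (T : Tri A part w a na b nb c nc) {i₀ i₁ : ℤ} (hi : i₀ < i₁)
    (hin : i₁ ≤ i₀ + na) (h₀ : OutS A b (a i₀)) (h₁ : InS A c (a i₁))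
    (hmid : ∀ t, i₀ < t → t < i₁ → OutS A b (a t) → ¬ InS A c (a t)) (j k : ℤ) :
    part (b (j + 1)) = part (a i₀) ∨ part (c k) = part (a i₁) ∨ ¬ A (b j) (c (k + 1)) := by
  by_contra! hcon
  obtain ⟨e1, e2, e3⟩ := hcon
  have hwt := T.ab.wt
  have hb := T.ab.right
  have hc := T.bc.right
  have hB := sg_ends b (show j + 1 < j + 1 + nb by have := hb.pos; omega)
  have hC := sg_ends c (show k + 1 < k + 1 + nc by have := hc.pos; omega)
  rw [show j + 1 + nb - 1 = j + nb by ring, hb.per] at hB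
  rw [show k + 1 + nc - 1 = k + nc by ring, hc.per] at hC
  refine T.link (W := sg b (j + 1) (j + 1 + nb) ++ sg c (k + 1) (k + 1 + nc))
    ((hb.sg_rotated_zero _).perm.symm.append (hc.sg_rotated_zero _).perm.symm) ?_
    (hB.append hC) hi hin (h₀.arc hwt e1) (h₁.arc hwt e2) ?_
  · rw [pw_append hB hC, hb.pw_sg, hc.pw_sg, hwt.arc e3, add_sub_cancel_right,
      add_sub_cancel_right]
    linarith [hwt.le_one (b j) (b (j + 1)), hwt.le_one (c k) (c (k + 1))]
  · intro t ht1 ht2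
    by_cases hX : OutS A b (a t)
    · obtain ⟨p, h1, h2⟩ := T.ca.good_right T.gca (hmid t ht1 ht2 hX)
      rcases hc.cedge (k + 1) p with h | h
      · exact Or.inr (Or.inr ⟨_, _, h.append_left _, h1, h2⟩)
      · exact Or.inr (Or.inl ((hC.unique h).2 ▸ h1))
    · obtain ⟨p, h1, h2⟩ := T.ab.good_left T.gab hX
      rcases hb.cedge (j + 1) p with h | h
      · exact Or.inr (Or.inr ⟨_, _, h.append_right _, h1, h2⟩)
      · exact Or.inl ((hB.unique h).1 ▸ h2)

/-- A transitive relation holds between all out-singular and in-singular vertices as soon as it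
holds for those pairs to which `Tri.edge_cases` applies. -/
lemma Tri.forall_pairs (T : Tri A part w a na b nb c nc) {φ : V → V → Prop}
    (htrans : ∀ x y z, φ x y → φ y z → φ x z)
    (hφ : ∀ i₀ i₁, i₀ < i₁ → i₁ ≤ i₀ + na → OutS A b (a i₀) → InS A c (a i₁) →
      (∀ t, i₀ < t → t < i₁ → OutS A b (a t) → ¬ InS A c (a t)) → φ (a i₀) (a i₁))
    {i i' : ℤ} (hi : OutS A b (a i)) (hi' : InS A c (a i')) : φ (a i) (a i') := by
  have key : ∀ (g : ℕ) (i i' : ℤ), i' = i + g → i < i' → i' ≤ i + na → OutS A b (a i) →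
      InS A c (a i') → φ (a i) (a i') := by
    intro g
    induction g using Nat.strong_induction_on with
    | _ g ih =>
      intro i i' e h1 h2 hi hi'
      by_cases h : ∃ t, i < t ∧ t < i' ∧ OutS A b (a t) ∧ InS A c (a t)
      · obtain ⟨t, ht1, ht2, ht3, ht4⟩ := h
        exact htrans _ _ _
          (ih (t - i).toNat (by omega) i t (by omega) ht1 (by omega) hi ht4)
          (ih (i' - t).toNat (by omega) t i' (by omega) ht2 (by omega) ht3 hi')
      · push Not at h
        exact hφ i i' h1 h2 hi hi' h
  obtain ⟨q, h1, h2⟩ := T.ab.left.window i' (i + 1)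
  have := key (i' + na * q - i).toNat i (i' + na * q) (by omega) (by omega) (by omega) hi
    (by rwa [T.ab.left.per_mul])
  rwa [T.ab.left.per_mul] at this

lemma Tri.out_pair (T : Tri A part w a na b nb c nc) {i₀ i₁ : ℤ} (hi : i₀ < i₁)
    (hin : i₁ ≤ i₀ + na) (h₀ : OutS A b (a i₀)) (h₁ : InS A c (a i₁))
    (hmid : ∀ t, i₀ < t → t < i₁ → OutS A b (a t) → ¬ InS A c (a t)) {j : ℤ}
    (hj : OutS A c (b j)) : part (b (j + 1)) = part (a i₀) ∨ part (b j) = part (a i₁) := by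
  by_contra! hcon
  have h : ∀ k, part (c k) = part (a i₁) ∨ part (c (k + 1)) = part (b j) := by
    intro k
    rcases T.edge_cases hi hin h₀ h₁ hmid j k with h | h | h
    · exact absurd h hcon.1
    · exact Or.inl h
    · by_contra! h'
      exact h (hj.arc T.ab.wt h'.2)
  rcases T.ca.left.forall_part (Ne.symm hcon.2) h with h | h
  · exact T.ca.not_forall_part _ h
  · exact T.bc.symm.not_forall_part _ h

lemma Tri.in_pair (T : Tri A part w a na b nb c nc) {i₀ i₁ : ℤ} (hi : i₀ < i₁)
    (hin : i₁ ≤ i₀ + na) (h₀ : OutS A b (a i₀)) (h₁ : InS A c (a i₁))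
    (hmid : ∀ t, i₀ < t → t < i₁ → OutS A b (a t) → ¬ InS A c (a t)) {k : ℤ}
    (hk : InS A b (c k)) : part (c (k - 1)) = part (a i₁) ∨ part (c k) = part (a i₀) := by
  by_contra! hcon
  have h : ∀ j, part (b j) = part (c k) ∨ part (b (j + 1)) = part (a i₀) := by
    intro j
    rcases T.edge_cases hi hin h₀ h₁ hmid j (k - 1) with h | h | h
    · exact Or.inr h
    · exact absurd h hcon.1
    · rw [sub_add_cancel] at h
      by_contra! h'
      exact h (hk.arc T.ab.wt h'.1)
  rcases T.bc.left.forall_part hcon.2 h with h | h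
  · exact T.bc.not_forall_part _ h
  · exact T.ab.symm.not_forall_part _ h

lemma Tri.out_arc (T : Tri A part w a na b nb c nc) {i i' j : ℤ} (hi : OutS A b (a i))
    (hi' : InS A c (a i')) (hj : OutS A c (b j)) (harc : A (b j) (b (j + 1))) :
    part (b (j + 1)) = part (a i) ∨ part (b j) = part (a i') :=
  T.forall_pairs (φ := fun x y => part (b (j + 1)) = part x ∨ part (b j) = part y)
    (by
      rintro x y z (h | h) (h' | h')
      · exact Or.inl h
      · exact Or.inl h
      · exact absurd (h.trans h'.symm) (T.ab.wt.ne harc)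
      · exact Or.inr h')
    (fun _ _ h1 h2 h3 h4 h5 => T.out_pair h1 h2 h3 h4 h5 hj) hi hi'

lemma Tri.in_arc (T : Tri A part w a na b nb c nc) {i i' k : ℤ} (hi : OutS A b (a i))
    (hi' : InS A c (a i')) (hk : InS A b (c k)) (harc : A (c (k - 1)) (c k)) :
    part (c (k - 1)) = part (a i') ∨ part (c k) = part (a i) :=
  T.forall_pairs (φ := fun x y => part (c (k - 1)) = part y ∨ part (c k) = part x)
    (by
      rintro x y z (h | h) (h' | h')
      · exact Or.inl h'
      · exact absurd (h.trans h'.symm) (T.ab.wt.ne harc)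
      · exact Or.inr h
      · exact Or.inr h)
    (fun _ _ h1 h2 h3 h4 h5 => T.in_pair h1 h2 h3 h4 h5 hk) hi hi'

end Triples

section NoTriple

variable {w : V → V → ℤ} {a b c : ℤ → V} {na nb nc : ℤ}

lemma Tri.exists_back (T : Tri A part w a na b nb c nc) : ∃ j k, A (c k) (b j) := by
  by_contra! hcon
  have hwt := T.ab.wt
  have hXb : ∀ j, OutS A c (b j) := fun j k => hcon j k
  have same : ∀ {i i'}, OutS A b (a i) → InS A c (a i') → part (a i) = part (a i') := by
    intro i i' hi hi'
    refine T.forall_pairs (φ := fun x y => part x = part y) (fun _ _ _ => Eq.trans) ?_ hi hi'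
    intro i₀ i₁ h1 h2 h3 h4 h5
    by_contra hne
    have h : ∀ j, part (b j) = part (a i₁) ∨ part (b (j + 1)) = part (a i₀) :=
      fun j => (T.out_pair h1 h2 h3 h4 h5 (hXb j)).symm
    exact T.ab.symm.not_edges_part (Ne.symm hne) h
  by_cases hX : ∃ i, OutS A b (a i) ∧ ¬ OutS A b (a (i + 1))
  · obtain ⟨i, hi, hi1⟩ := hX
    obtain ⟨j, hj⟩ := not_outS.1 hi1
    obtain ⟨e1, -, -, j', hj', e2, e3⟩ := T.ab.back_arc T.gab (i₁ := i) hj rfl rfl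
    obtain ⟨k, hk1, -, hk⟩ := T.ca.right.exists_window (p := InS A c) T.gca.2.2.1 (i + 1)
    obtain ⟨i', ⟨hi1', hi'⟩, hmin⟩ := Int.exists_least_of_bdd
      (P := fun t => i < t ∧ InS A c (a t)) ⟨i, fun z hz => hz.1.le⟩ ⟨k, by omega, hk⟩
    have hs := same hi hi'
    have hne : i' ≠ i + 1 := by
      rintro rfl
      exact hwt.ne e1 hs
    have hY : ¬ InS A c (a (i' - 1)) :=
      fun h => absurd (hmin _ ⟨by omega, h⟩) (by omega)
    obtain ⟨l, hl⟩ := not_inS.1 hY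
    have e4 := (T.ca.back_arc T.gca (i₁ := l - 1) (j₂ := i') hl (by ring) (by ring)).2.1
    rcases T.rotate.in_arc (hXb (j' - 1)) hj' hi' e4 with h | h
    · exact hwt.ne e4 (h.trans (e3.trans hs))
    · exact hwt.ne e2 (h.symm.trans (hs.symm.trans e3.symm))
  · push Not at hX
    have hXa : ∀ i, OutS A b (a i) := T.ab.left.forall_of_step T.gab.1 hX
    obtain ⟨i', hi'⟩ := T.gca.2.2.1
    have hall : ∀ i, part (a i) = part (a i') := fun i => same (hXa i) hi'
    have hpos := T.ab.left.pos
    rcases T.out_pair (i₀ := i' - 1) (i₁ := i') (by omega) (by omega) (hXa _) hi'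
      (fun t _ _ => by omega) (hXb 0) with h | h
    · exact T.ab.not_forall_part _ fun i => (hall i).trans ((hall _).symm.trans h.symm)
    · exact T.ab.not_forall_part _ fun i => (hall i).trans h.symm

/-- The data provided by the last out-singular vertex `c i` of a run and an arc from `d j` to its
successor, together with an in-singular vertex `d j'` in the partite set of `c i`. -/
structure LastOut (A : V → V → Prop) (part : V → K) (c d : ℤ → V) (i j j' : ℤ) : Prop where
  out : OutS A d (c i)
  arc : A (c i) (c (i + 1))
  back : A (d j) (c (i + 1))
  part_succ : part (d (j + 1)) = part (c i)
  arc_back : A (d j) (d (j + 1))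
  ins : InS A c (d j')
  arc_ins : A (d (j' - 1)) (d j')
  part_ins : part (d j') = part (c i)

lemma Unm.exists_lastOut {d : ℤ → V} {n m : ℤ} (U : Unm A part w c n d m) (hg : Gt A c d)
    (h : ∃ i j, A (d j) (c i)) : ∃ i j j', LastOut A part c d i j j' := by
  obtain ⟨i, hi, hi1⟩ : ∃ i, OutS A d (c i) ∧ ¬ OutS A d (c (i + 1)) := by
    by_contra! hcon
    obtain ⟨i, j, hij⟩ := h
    exact U.left.forall_of_step hg.1 hcon i j hij
  obtain ⟨j, hj⟩ := not_outS.1 hi1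
  obtain ⟨e1, e2, e3, j', e4, e5, e6⟩ := U.back_arc hg (i₁ := i) hj rfl rfl
  exact ⟨i, j, j', hi, e1, hj, e3.symm, e2, e4, e5, e6⟩

lemma Tri.no_coincidence (T : Tri A part w a na b nb c nc) {xa jb yb xb jc yc xc ja ya : ℤ}
    (Sa : LastOut A part a b xa jb yb) (Sb : LastOut A part b c xb jc yc)
    (Sc : LastOut A part c a xc ja ya) (hP : part (b (xb + 1)) = part (a xa)) : False := by
  have hwt := T.ab.wt
  have hb := T.ab.right
  have hc := T.bc.right
  have hPQ : part (a xa) ≠ part (b xb) := fun h => hwt.ne Sb.arc (h.symm.trans hP.symm)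
  have haR : part (a (xa + 1)) = part (c xc) :=
    (T.rotate.rotate.out_arc Sc.out Sb.ins Sa.out Sa.arc).resolve_right
      fun h => hPQ (h.trans Sb.part_ins)
  have hPR : part (a xa) ≠ part (c xc) := fun h => hwt.ne Sa.arc (h.trans haR.symm)
  have hbQ : part (b (yb - 1)) = part (b xb) :=
    ((T.rotate.rotate.in_arc Sc.out Sb.ins Sa.ins Sa.arc_ins).resolve_right
      fun h => hPR (Sa.part_ins.symm.trans h)).trans Sb.part_ins
  have hcR' : ∀ {y}, InS A c (a y) → part (c (yc - 1)) = part (a y) := fun hy =>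
    (T.in_arc Sa.out hy Sb.ins Sb.arc_ins).resolve_right
      fun h => hPQ (h.symm.trans Sb.part_ins)
  have hcR : part (c (yc - 1)) = part (c xc) := (hcR' Sc.ins).trans Sc.part_ins
  have hQR : part (b xb) ≠ part (c xc) :=
    fun h => hwt.ne Sb.arc_ins (hcR.trans (h.symm.trans Sb.part_ins.symm))
  have hYa : ∀ {y}, InS A c (a y) → part (a y) = part (c xc) :=
    fun hy => (hcR' hy).symm.trans hcR
  have hYb' : ∀ {y}, InS A a (b y) → part (a (ya - 1)) = part (b y) := fun hy =>
    (T.rotate.in_arc Sb.out hy Sc.ins Sc.arc_ins).resolve_right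
      fun h => hQR (h.symm.trans Sc.part_ins)
  have hYb : ∀ {y}, InS A a (b y) → part (b y) = part (a xa) :=
    fun hy => (hYb' hy).symm.trans ((hYb' Sa.ins).trans Sa.part_ins)
  have hYc : ∀ {y}, InS A b (c y) → part (c y) = part (b xb) := fun hy =>
    ((T.rotate.rotate.in_arc Sc.out hy Sa.ins Sa.arc_ins).resolve_right
      fun h => hPR (Sa.part_ins.symm.trans h)).symm.trans hbQ
  have hXa : ∀ {x}, OutS A b (a x) → part (a x) = part (a xa) := fun hx =>
    ((T.out_arc hx Sc.ins Sb.out Sb.arc).resolve_right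
      fun h => hQR (h.trans Sc.part_ins)).symm.trans hP
  -- a stretch of `a` from an out-singular vertex to an in-singular one
  obtain ⟨i₀, i₁, hi, hin, hi₀, hi₁, hbetw⟩ : ∃ i₀ i₁, i₀ < i₁ ∧ i₁ ≤ i₀ + na ∧ OutS A b (a i₀) ∧
      InS A c (a i₁) ∧ ∀ t, i₀ < t → t < i₁ → ¬ OutS A b (a t) ∧ ¬ InS A c (a t) := by
    obtain ⟨k, hk1, hk2, hk⟩ := T.ca.right.exists_window (p := InS A c) T.gca.2.2.1 (xa + 1)
    obtain ⟨i₁, ⟨h1, h2⟩, hmin⟩ := Int.exists_least_of_bdd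
      (P := fun t => xa < t ∧ InS A c (a t)) ⟨xa, fun z hz => hz.1.le⟩ ⟨k, by omega, hk⟩
    obtain ⟨i₀, ⟨h3, h4, h5⟩, hmax⟩ := Int.exists_greatest_of_bdd
      (P := fun t => xa ≤ t ∧ t < i₁ ∧ OutS A b (a t)) ⟨i₁, fun z hz => hz.2.1.le⟩
      ⟨xa, le_rfl, h1, Sa.out⟩
    have := hmin k ⟨by omega, hk⟩
    exact ⟨i₀, i₁, h4, by omega, h5, h2, fun t ht1 ht2 =>
      ⟨fun h => absurd (hmax t ⟨by omega, ht2, h⟩) (by omega),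
        fun h => absurd (hmin t ⟨by omega, h⟩) (by omega)⟩⟩
  obtain ⟨q, rfl⟩ : ∃ q, jc = q - 1 := ⟨jc + 1, by ring⟩
  have hback := Sb.back
  have hqQ := Sb.part_succ
  have hqarc := Sb.arc_back
  rw [sub_add_cancel] at hqQ hqarc
  have hbackQ : ∀ {i j}, A (c j) (b i) → A (b (i - 1)) (b i) ∧ A (c j) (c (j + 1)) ∧
      part (c (j + 1)) = part (b xb) ∧ part (b (i - 1)) = part (b xb) := by
    intro i j h
    obtain ⟨e1, e2, e3, j', e4, -, e5⟩ := T.bc.back_arc T.gbc (i₁ := i - 1) h (by ring) rfl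
    have e6 := e5.symm.trans (hYc e4)
    exact ⟨e1, e2, e3.symm.trans e6, e6⟩
  have hbxQ : part (b (xb - 1)) ≠ part (b xb) := by
    intro h
    have Z := T.bc.same_same (i := xb - 1) (i' := xb) (j := q) (j₁ := q - 1) (by ring) (by ring)
      rfl h hqQ.symm
    obtain ⟨e1, -, -, e2⟩ := hbackQ Z.1
    exact hwt.ne e1 (e2.trans h.symm)
  have hbq : A (b (xb - 1)) (c q) := by
    refine hwt.arc_of_not (fun h => ?_) (fun h => hbxQ (h.symm.trans hqQ))
    obtain ⟨-, e1, e2, -⟩ := hbackQ h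
    exact hwt.ne e1 (hqQ.trans e2.symm)
  have hnb : nb ≠ 1 := by
    rintro rfl
    exact hbxQ (by rw [hb.per_sub])
  have hnb0 := hb.pos
  obtain ⟨z, hz1, hz2, hzR, hzQ⟩ : ∃ z, q < z ∧ z < q + nc ∧ part (c (z - 1)) ≠ part (c xc) ∧
      part (c z) ≠ part (b xb) := by
    by_contra! hcon
    have : ∀ i, part (c i) = part (c xc) ∨ part (c (i + 1)) = part (b xb) := by
      intro i
      by_contra! h
      obtain ⟨s, h1, h2⟩ := hc.window (i + 1) (q + 1)
      have hper := hc.per_mul (i + 1) s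
      rcases eq_or_ne (i + 1 + nc * s) (q + nc) with h3 | h3
      · rw [h3, hc.per] at hper
        exact h.2 (hper ▸ hqQ)
      · refine h.2 (hper ▸ hcon _ (by omega) (by omega) ?_)
        rw [show i + 1 + nc * s - 1 = i + nc * s by ring, hc.per_mul]
        exact h.1
    rcases hc.forall_part hQR.symm this with h | h
    · exact T.ca.not_forall_part ya fun i => (h i).trans Sc.part_ins.symm
    · exact T.bc.symm.not_forall_part xb h
  have E1 := ends_singleton (b xb)
  have E2 := sg_ends c (show z < q + nc by omega)
  have E3 := sg_ends b (show xb + 1 < xb + nb by omega)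
  have E4 := sg_ends c (show q < z by omega)
  rw [show q + nc - 1 = q - 1 + nc by ring, hc.per] at E2
  rw [show xb + nb - 1 = xb - 1 + nb by ring, hb.per] at E3
  have wz : w (b xb) (c z) = 1 := hwt.arc (Sb.out.arc hwt hzQ)
  have hcfull := hc.pw_sg (w := w) z
  rw [← sg_append c (show z ≤ q + nc by omega) (by omega), hc.sg_shift, pw_append E2 E4,
    hwt.arc hqarc] at hcfull
  have hbfull := hb.pw_sg (w := w) xb
  rw [← sg_append b (show xb ≤ xb + 1 by omega) (by omega), sg_one, pw_append E1 E3] at hbfull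
  have l1 := hwt.le_one (c (z - 1)) (c z)
  have l2 := hwt.le_one (b xb) (b (xb + 1))
  have l3 := hwt.le_one (b (xb - 1)) (b xb)
  refine T.link (W := [b xb] ++ (sg c z (q + nc) ++ (sg b (xb + 1) (xb + nb) ++ sg c q z)))
    ?_ ?_ (E1.append (E2.append (E3.append E4))) hi hin ?_ ?_ ?_
  · have p1 := (hb.sg_rotated_zero xb).perm
    rw [← sg_append b (show xb ≤ xb + 1 by omega) (by omega), sg_one] at p1
    have p2 := (hc.sg_rotated_zero z).perm
    rw [← sg_append c (show z ≤ q + nc by omega) (by omega), hc.sg_shift] at p2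
    refine List.Perm.trans ?_ (p1.append p2).symm
    rw [List.append_assoc]
    refine List.Perm.append_left _ ?_
    rw [← List.append_assoc, ← List.append_assoc]
    exact List.perm_append_comm.append_right _
  · rw [pw_append E1 (E2.append (E3.append E4)), pw_append E2 (E3.append E4), pw_append E3 E4,
      wz, hwt.arc hback, hwt.arc hbq]
    omega
  · exact hi₀.arc hwt fun h => hPQ ((hXa hi₀).symm.trans h.symm)
  · exact hi₁.arc hwt fun h => hzR (h.trans (hYa hi₁))
  · intro t ht1 ht2
    refine Or.inr (Or.inr ?_)
    obtain ⟨hX, hY⟩ := hbetw t ht1 ht2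
    obtain ⟨k, h1, h2⟩ := T.ca.good_right T.gca hY
    have hkR : part (c k) = part (c xc) := by
      obtain ⟨-, -, -, j', e4, -, e5⟩ := T.ca.back_arc T.gca (i₁ := k) h2 rfl rfl
      exact e5.symm.trans (hYa e4)
    have hk := hc.cedge z k
    rw [← sg_append c (show z ≤ q + nc by omega) (by omega), hc.sg_shift] at hk
    rcases hk with hk | hk
    · rcases adj_append_cases hk with hk | hk | ⟨hk, -⟩
      · exact ⟨_, _, (hk.append_right _).append_left _, h1, h2⟩
      · exact ⟨_, _, ((hk.append_left _).append_left _).append_left _, h1, h2⟩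
      · obtain hk : c (q - 1) = c k := by simpa using E2.2.symm.trans hk
        refine ⟨c (q - 1), b (xb + 1), ?_, hk ▸ h1, ?_⟩
        · exact (adj_append E2 (E3.append E4)).append_left _
        · obtain ⟨j, hj⟩ := not_outS.1 hX
          obtain ⟨e1, -, -, j', e2, -, e3⟩ := T.ab.back_arc T.gab (i₁ := t - 1) hj (by ring) rfl
          have e4 := e3.symm.trans (hYb e2)
          refine hwt.arc_of_not (fun h => ?_) (fun h => hwt.ne e1 (e4.trans (hP.symm.trans h)))
          obtain ⟨-, e5, e6, -⟩ := T.ab.back_arc T.gab (i₁ := t - 1) h (by ring) rfl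
          exact hwt.ne e5 (hP.trans (e4.symm.trans e6))
    · have := (hk.unique (E2.append E4)).2
      exact absurd ((congrArg part this).symm.trans hkR) hzR

theorem Tri.false (T : Tri A part w a na b nb c nc) : False := by
  have hwt := T.ab.wt
  obtain ⟨xa, ja, ya, Sa⟩ := T.ab.exists_lastOut T.gab
    (by obtain ⟨i, j, h⟩ := T.rotate.rotate.exists_back; exact ⟨i, j, h⟩)
  obtain ⟨xb, jb, yb, Sb⟩ := T.bc.exists_lastOut T.gbc T.exists_back
  obtain ⟨xc, jc, yc, Sc⟩ := T.ca.exists_lastOut T.gca T.rotate.exists_back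
  by_cases h1 : part (b (xb + 1)) = part (a xa)
  · exact T.no_coincidence Sa Sb Sc h1
  by_cases h2 : part (c (xc + 1)) = part (b xb)
  · exact T.rotate.no_coincidence Sb Sc Sa h2
  by_cases h3 : part (a (xa + 1)) = part (c xc)
  · exact T.rotate.rotate.no_coincidence Sc Sa Sb h3
  have hpos := T.ab.left.pos
  have hb := T.ab.right
  have hc := T.bc.right
  have hB := sg_ends b (show xb + 1 < xb + 1 + nb by have := hb.pos; omega)
  have hC := sg_ends c (show xc + 1 < xc + 1 + nc by have := hc.pos; omega)
  rw [show xb + 1 + nb - 1 = xb + nb by ring, hb.per] at hB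
  rw [show xc + 1 + nc - 1 = xc + nc by ring, hc.per] at hC
  refine T.link (W := sg b (xb + 1) (xb + 1 + nb) ++ sg c (xc + 1) (xc + 1 + nc))
    ((hb.sg_rotated_zero _).perm.symm.append (hc.sg_rotated_zero _).perm.symm) ?_
    (hB.append hC) (i₀ := xa) (i₁ := xa + 1) (by omega) (by omega) (Sa.out.arc hwt h1)
    (Sc.out.arc hwt h3) (fun t _ _ => by omega)
  rw [pw_append hB hC, hb.pw_sg, hc.pw_sg, hwt.arc (Sb.out.arc hwt h2), add_sub_cancel_right,
    add_sub_cancel_right]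
  linarith [hwt.le_one (b xb) (b (xb + 1)), hwt.le_one (c xc) (c (xc + 1))]

end NoTriple

/-! ### From G-cycles to periodic parametrizations and back -/

/-- The weight counting arcs, in which a pair unusable for G-cycles costs `N`. -/
noncomputable def arcWt (A : V → V → Prop) (part : V → K) (N : ℤ) (x y : V) : ℤ :=
  if A x y then 1 else if part x = part y then 0 else -N

lemma arcWt_wt (h : IsSMD A part) {N : ℤ} (hN : 10 ≤ N) : Wt A part (arcWt A part N) where
  smd := h
  arc hA := if_pos hA
  same hp := by simp [arcWt, h.noInside _ _ hp, hp]
  pen hA hp := by simp [arcWt, hA, hp, hN]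

lemma pw_arcWt (N : ℤ) : ∀ l : List V, l.IsChain (fun x y => A x y ∨ part x = part y) →
    pw (arcWt A part N) l = (l.zip l.tail).countP fun q => decide (A q.1 q.2)
  | [], _ => by simp [pw]
  | [a], _ => by simp [pw]
  | a :: b :: l, h => by
    rw [List.isChain_cons_cons] at h
    have ih := pw_arcWt N (b :: l) h.2
    simp only [pw, List.tail_cons, List.zip_cons_cons, List.countP_cons] at ih ⊢
    rw [ih]
    by_cases hA : A a b
    · simp [arcWt, hA]; ring
    · simp [arcWt, hA, h.1.resolve_left hA]

lemma cw_arcWt (N : ℤ) (a : V) (t : List V)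
    (h : (a :: t ++ [a]).IsChain fun x y => A x y ∨ part x = part y) :
    cw (arcWt A part N) (a :: t) =
      ((a :: t).zip ((a :: t).rotate 1)).countP fun q => decide (A q.1 q.2) := by
  rw [cw, pw_arcWt N _ h]
  congr 2
  have := List.zip_append (l₁ := a :: t) (l₂ := t ++ [a]) (r₁ := [a]) (r₂ := []) (by simp)
  simpa using this

lemma pw_arcWt_le {N : ℤ} (hN : 0 ≤ N) : ∀ l : List V,
    pw (arcWt A part N) l ≤ l.length ∧
      (l.IsChain (fun x y => A x y ∨ part x = part y) ∨ pw (arcWt A part N) l + N ≤ l.length)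
  | [] => by simp [pw]
  | [a] => by simp [pw]
  | a :: b :: l => by
    obtain ⟨h1, h2⟩ := pw_arcWt_le hN (b :: l)
    simp only [pw, List.isChain_cons_cons, List.length_cons] at *
    push_cast at *
    have hle : arcWt A part N a b ≤ 1 := by
      unfold arcWt; split_ifs <;> omega
    by_cases hab : A a b ∨ part a = part b
    · refine ⟨by omega, ?_⟩
      rcases h2 with h2 | h2
      · exact Or.inl ⟨hab, h2⟩
      · right; omega
    · have : arcWt A part N a b = -N := by
        push Not at hab
        simp [arcWt, hab]
      exact ⟨by omega, by right; omega⟩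

/-- The periodic parametrization of a G-cycle. -/
noncomputable def fn (C : GCycle A part) (i : ℤ) : V :=
  C.verts[(i % C.verts.length).toNat]'(by
    have h0 : (0 : ℤ) < C.verts.length := by exact_mod_cast List.length_pos_of_ne_nil C.ne
    have h1 := Int.emod_lt_of_pos i h0
    have h2 := Int.emod_nonneg i h0.ne'
    omega)

section GCycle

variable (C D : GCycle A part)

lemma length_verts_pos : 0 < C.verts.length := List.length_pos_of_ne_nil C.ne

lemma fn_natCast (k : ℕ) (hk : k < C.verts.length) : fn C k = C.verts[k] := by
  unfold fn
  congr 1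
  rw [Int.emod_eq_of_lt] <;> omega

lemma isChain_verts_append :
    (C.verts ++ [C.verts.head C.ne]).IsChain fun x y => A x y ∨ part x = part y := by
  rw [List.isChain_append]
  refine ⟨C.chain, by simp, fun x hx y hy => ?_⟩
  rw [List.getLast?_eq_some_getLast C.ne] at hx
  simp only [List.head?_cons, Option.mem_def, Option.some.injEq] at hx hy
  subst hx hy
  exact C.close

lemma cyc_fn : Cyc A part (fn C) C.verts.length where
  pos := by exact_mod_cast length_verts_pos C
  per i := by simp [fn]
  edge i := by
    have h0 : (0 : ℤ) < C.verts.length := by exact_mod_cast length_verts_pos C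
    have h1 := Int.emod_lt_of_pos i h0
    have h2 := Int.emod_nonneg i h0.ne'
    obtain ⟨k, hk⟩ := Int.eq_ofNat_of_zero_le h2
    have key : ∀ j : ℤ, fn C j = fn C (j % C.verts.length) := fun j => by simp [fn]
    have e1 : fn C i = fn C k := by rw [key, hk]
    have e2 : fn C (i + 1) = fn C ((k : ℤ) + 1) := by
      rw [key (i + 1), key ((k : ℤ) + 1), ← Int.emod_add_emod, hk]
    rw [e1, e2]
    have hkn : k < C.verts.length := by omega
    rw [fn_natCast C k hkn]
    by_cases hl : k + 1 < C.verts.length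
    · have e3 : fn C ((k : ℤ) + 1) = C.verts[k + 1] := by
        exact_mod_cast fn_natCast C (k + 1) hl
      rw [e3]
      exact List.isChain_iff_getElem.1 C.chain k hl
    · have hk1 : k + 1 = C.verts.length := by omega
      have e3 : fn C ((k : ℤ) + 1) = C.verts[0] := by
        rw [key, ← fn_natCast C 0 (by omega)]
        congr 1
        rw [← hk1]; simp
      have e4 : C.verts[k] = C.verts.getLast C.ne := by
        rw [List.getLast_eq_getElem]
        congr 1; omega
      rw [e3, e4, List.getElem_zero]
      exact C.close

lemma sg_fn : sg (fn C) 0 C.verts.length = C.verts := by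
  apply List.ext_getElem
  · simp [sg]
  · intro k h1 h2
    simp only [sg, List.getElem_map, List.getElem_range, zero_add]
    exact fn_natCast C k h2

variable {C D}

lemma fn_mem (i : ℤ) : fn C i ∈ C.verts := List.getElem_mem _

lemma exists_fn_eq {v : V} (hv : v ∈ C.verts) : ∃ i, fn C i = v := by
  obtain ⟨k, hk, rfl⟩ := List.getElem_of_mem hv
  exact ⟨k, fn_natCast C k hk⟩

lemma cw_verts (N : ℤ) : cw (arcWt A part N) C.verts = C.len := by
  obtain ⟨⟨l, h0, h1, h2⟩, h3⟩ := C
  obtain ⟨a, t, rfl⟩ := List.exists_cons_of_ne_nil h0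
  exact cw_arcWt N a t (isChain_verts_append ⟨⟨a :: t, h0, h1, h2⟩, h3⟩)

lemma exists_gCycle {l : List V} {N : ℤ} (h0 : l ≠ []) (hl : l.Nodup) (hN : l.length + 1 < N)
    (hw : 0 ≤ cw (arcWt A part N) l) : ∃ C : GCycle A part, C.verts = l ∧
      (C.len : ℤ) = cw (arcWt A part N) l := by
  obtain ⟨a, t, rfl⟩ := List.exists_cons_of_ne_nil h0
  have h := (pw_arcWt_le (A := A) (part := part) (N := N) (by omega)
    (a :: t ++ [a])).2.resolve_right (by
      rw [cw] at hw
      simp only [List.length_append, List.length_cons, List.length_nil] at hN ⊢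
      push_cast at hN ⊢
      omega)
  have h' := List.isChain_append.1 h
  refine ⟨⟨⟨a :: t, h0, hl, h'.1⟩, ?_⟩, rfl, (cw_arcWt N a t h).symm⟩
  exact h'.2.2 _ (List.getLast?_eq_some_getLast h0) _ (by simp)

lemma outS_fn (h : IsSMD A part) {v : V} : OutS A (fn C) v ↔ C.OutSingular v := by
  constructor
  · intro hv w hw
    obtain ⟨i, rfl⟩ := exists_fn_eq hw
    exact ⟨fun hp => (h.adj _ _ hp).resolve_right (hv i), hv i⟩
  · exact fun hv i => (hv _ (fn_mem i)).2

lemma inS_fn (h : IsSMD A part) {v : V} : InS A (fn C) v ↔ C.InSingular v := by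
  constructor
  · intro hv w hw
    obtain ⟨i, rfl⟩ := exists_fn_eq hw
    exact ⟨fun hp => (h.adj _ _ hp).resolve_left (hv i), hv i⟩
  · exact fun hv i => (hv _ (fn_mem i)).2

lemma Gt.simGt (h : IsSMD A part) (hg : Gt A (fn C) (fn D)) : SimGt C D := by
  obtain ⟨⟨i, hi⟩, h1, ⟨j, hj⟩, h2⟩ := hg
  refine ⟨⟨_, fn_mem i, Or.inl ((outS_fn h).1 hi)⟩, fun v hv hs => hs.resolve_right fun hs => ?_,
    ⟨_, fn_mem j, Or.inr ((inS_fn h).1 hj)⟩, fun v hv hs => hs.resolve_left fun hs => ?_⟩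
  · obtain ⟨k, rfl⟩ := exists_fn_eq hv
    exact h1 k ((inS_fn h).2 hs)
  · obtain ⟨k, rfl⟩ := exists_fn_eq hv
    exact h2 k ((outS_fn h).2 hs)

end GCycle

/-! ### Irreducible factors -/

/-- A G-cycle factor is irreducible if no G-cycle factor with at least as many arcs and fewer
G-cycles arises from it by uniting vertex sets of G-cycles. -/
def Irred (F : GCSub A part) : Prop :=
  ¬ ∃ F' : GCSub A part, F'.IsFactor ∧ F.arcs ≤ F'.arcs ∧
    F'.cycles.length < F.cycles.length ∧
    ∀ C ∈ F.cycles, ∃ C' ∈ F'.cycles, ∀ x ∈ C.toGPath.verts, x ∈ C'.toGPath.verts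

lemma Irred.cw_lt [Fintype V] {F : GCSub A part} (hirr : Irred F) (hF : F.IsFactor)
    {Cs rest : List (GCycle A part)} (hp : F.cycles.Perm (Cs ++ rest)) (h2 : 2 ≤ Cs.length)
    {l : List V} (hl : l.Perm (Cs.map fun C => C.verts).flatten) :
    cw (arcWt A part (Fintype.card V + 10)) l < ((Cs.map GCycle.len).sum : ℕ) := by
  by_contra! hcon
  have hsymm : ∀ {C D : GCycle A part}, (∀ x ∈ C.verts, x ∉ D.verts) →
      ∀ x ∈ D.verts, x ∉ C.verts := fun h x hx hx' => h x hx' hx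
  have hpw := (hp.pairwise_iff hsymm).1 F.disj
  rw [List.pairwise_append] at hpw
  obtain ⟨hCs, hrest, hcross⟩ := hpw
  have hnd : l.Nodup := by
    rw [hl.nodup_iff, List.nodup_flatten]
    refine ⟨fun l hl => ?_, ?_⟩
    · obtain ⟨C, -, rfl⟩ := List.mem_map.1 hl
      exact C.nodup
    · rw [List.pairwise_map]
      exact hCs.imp fun h x hx hx' => h x hx hx'
  have hmem : ∀ {x}, x ∈ l ↔ ∃ C ∈ Cs, x ∈ C.verts := by simp [hl.mem_iff]
  have hne : l ≠ [] := by
    obtain ⟨C, hC⟩ := List.exists_mem_of_length_pos (by omega : 0 < Cs.length)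
    obtain ⟨x, hx⟩ := List.exists_mem_of_ne_nil _ C.ne
    exact List.ne_nil_of_mem (hmem.2 ⟨C, hC, hx⟩)
  obtain ⟨E, hE, hlen⟩ := exists_gCycle (A := A) (part := part) (N := Fintype.card V + 10)
    hne hnd (by have := hnd.length_le_card; omega) (by omega)
  refine hirr ⟨⟨E :: rest, ?_⟩, ?_, ?_, ?_, ?_⟩
  · refine List.pairwise_cons.2 ⟨fun D hD x hx => ?_, hrest⟩
    rw [hE, hmem] at hx
    obtain ⟨C, hC, hx⟩ := hx
    exact hcross C hC D hD x hx
  · intro v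
    obtain ⟨C, hC, hv⟩ := hF v
    rcases List.mem_append.1 (hp.mem_iff.1 hC) with h | h
    · exact ⟨E, by simp, by rw [hE, hmem]; exact ⟨C, h, hv⟩⟩
    · exact ⟨C, by simp [h], hv⟩
  · have h1 := (hp.map GCycle.len).sum_eq
    simp only [GCSub.arcs, List.map_cons, List.sum_cons, List.map_append, List.sum_append] at h1 ⊢
    omega
  · have := hp.length_eq
    simp only [List.length_append, List.length_cons] at this ⊢
    omega
  · intro C hC
    rcases List.mem_append.1 (hp.mem_iff.1 hC) with h | h
    · exact ⟨E, by simp, fun x hx => by rw [hE, hmem]; exact ⟨C, h, hx⟩⟩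
    · exact ⟨C, by simp [h], fun x hx => hx⟩

lemma Irred.unm [Fintype V] {F : GCSub A part} (hirr : Irred F) (hF : F.IsFactor)
    (hSMD : IsSMD A part) {a b : GCycle A part} (ha : a ∈ F.cycles) (hb : b ∈ F.cycles)
    (hab : a ≠ b) : Unm A part (arcWt A part (Fintype.card V + 10)) (fn a) a.verts.length
      (fn b) b.verts.length := by
  have hp : F.cycles.Perm ([a, b] ++ (F.cycles.erase a).erase b) :=
    (List.perm_cons_erase ha).trans
      ((List.perm_cons_erase ((List.mem_erase_of_ne hab.symm).2 hb)).cons a)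
  refine ⟨arcWt_wt hSMD (by omega), cyc_fn a, cyc_fn b, fun l hl => ?_⟩
  rw [sg_fn, sg_fn] at hl ⊢
  have := hirr.cw_lt hF hp (by simp) (l := l) (by simpa using hl)
  simpa [cw_verts] using this

lemma Irred.gt_trans [Fintype V] {F : GCSub A part} (hirr : Irred F) (hF : F.IsFactor)
    (hSMD : IsSMD A part) {a b c : GCycle A part} (ha : a ∈ F.cycles) (hb : b ∈ F.cycles)
    (hc : c ∈ F.cycles) (gab : Gt A (fn a) (fn b)) (gbc : Gt A (fn b) (fn c)) :
    Gt A (fn a) (fn c) := by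
  have hasymm : ∀ {x y : GCycle A part}, Gt A (fn x) (fn y) → ¬ Gt A (fn y) (fn x) :=
    fun h h' => h'.2.2.2 _ h.1.choose_spec
  have hne : ∀ {x y : GCycle A part}, Gt A (fn x) (fn y) → x ≠ y := by
    rintro x _ h rfl
    exact hasymm h h
  have hac : a ≠ c := by
    rintro rfl
    exact hasymm gab gbc
  refine (hirr.unm hF hSMD ha hc hac).gt_or_gt.resolve_right fun gca => ?_
  have hp : F.cycles.Perm ([a, b, c] ++ ((F.cycles.erase a).erase b).erase c) :=
    (List.perm_cons_erase ha).trans <| .cons a <|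
      (List.perm_cons_erase ((List.mem_erase_of_ne (hne gab).symm).2 hb)).trans <| .cons b <|
        List.perm_cons_erase <| (List.mem_erase_of_ne (hne gbc).symm).2 <|
          (List.mem_erase_of_ne hac.symm).2 hc
  refine Tri.false (A := A) (part := part) (w := arcWt A part (Fintype.card V + 10))
    ⟨hirr.unm hF hSMD ha hb (hne gab), hirr.unm hF hSMD hb hc (hne gbc),
      hirr.unm hF hSMD hc ha hac.symm, gab, gbc, gca, fun l hl => ?_⟩
  rw [sg_fn, sg_fn, sg_fn] at hl ⊢
  have := hirr.cw_lt hF hp (by simp) (l := l) (by simpa using hl)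
  simpa [cw_verts, add_assoc] using this

/-- A relation which is total and transitive on a list sorts the list. -/
lemma exists_perm_pairwise {α : Type*} {r : α → α → Prop} : ∀ L : List α,
    L.Pairwise (fun a b => r a b ∨ r b a) →
    (∀ a ∈ L, ∀ b ∈ L, ∀ c ∈ L, r a b → r b c → r a c) → ∃ l : List α, l.Perm L ∧ l.Pairwise r
  | [], _, _ => ⟨[], by simp⟩
  | a :: L, htot, htr => by
    rw [List.pairwise_cons] at htot
    obtain ⟨l, hl, hr⟩ := exists_perm_pairwise L htot.2 fun x hx y hy z hz =>
      htr x (by simp [hx]) y (by simp [hy]) z (by simp [hz])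
    refine ⟨l.filter (fun x => r x a) ++ a :: l.filter (fun x => !decide (r x a)), ?_, ?_⟩
    · exact List.perm_middle.trans (.cons a ((List.filter_append_perm _ l).trans hl))
    · rw [List.pairwise_append, List.pairwise_cons]
      have hup : ∀ y ∈ l.filter (fun x => !decide (r x a)), r a y := fun y hy => by
        simp only [List.mem_filter, Bool.not_eq_true', decide_eq_false_iff_not] at hy
        exact (htot.1 y (hl.mem_iff.1 hy.1)).resolve_right hy.2
      refine ⟨hr.filter _, ⟨hup, hr.filter _⟩, fun x hx y hy => ?_⟩
      obtain ⟨hxl, hxa⟩ : x ∈ l ∧ r x a := by simpa using hx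
      rcases List.mem_cons.1 hy with rfl | hy
      · exact hxa
      · exact htr x (by simp [hl.mem_iff.1 hxl]) a (by simp) y
          (by simp [hl.mem_iff.1 (List.mem_of_mem_filter hy)]) hxa (hup y hy)

lemma Irred.exists_sorted [Fintype V] {F : GCSub A part} (hirr : Irred F) (hF : F.IsFactor)
    (hSMD : IsSMD A part) :
    ∃ l : List (GCycle A part), l.Perm F.cycles ∧ l.Pairwise SimGt := by
  obtain ⟨l, hl, hr⟩ := exists_perm_pairwise (r := fun a b => Gt A (fn a) (fn b)) F.cycles
    (F.disj.imp_of_mem fun {a b} ha hb h => (hirr.unm hF hSMD ha hb (by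
      rintro rfl
      obtain ⟨x, hx⟩ := List.exists_mem_of_ne_nil _ a.ne
      exact h x hx hx)).gt_or_gt)
    fun a ha b hb c hc => hirr.gt_trans hF hSMD ha hb hc
  exact ⟨l, hl, hr.imp (Gt.simGt hSMD)⟩

end GFactor

/-- The G-cycles of an irreducible G-cycle factor of a semicomplete
multipartite digraph can be labelled `C₁, …, C_k` so that `C_i ≃> C_j` whenever
`i < j`. -/
theorem stmt16 {V K : Type} [Fintype V] {A : V → V → Prop} {part : V → K}
    (hSMD : IsSMD A part) (F : GCSub A part) (hF : F.IsFactor)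
    (hirr : ¬ ∃ F' : GCSub A part, F'.IsFactor ∧ F.arcs ≤ F'.arcs ∧
      F'.cycles.length < F.cycles.length ∧
      ∀ C ∈ F.cycles, ∃ C' ∈ F'.cycles, ∀ x ∈ C.toGPath.verts, x ∈ C'.toGPath.verts) :
    ∃ l : List (GCycle A part), l.Perm F.cycles ∧ l.Pairwise SimGt :=
  GFactor.Irred.exists_sorted hirr hF hSMD
end

section
/- Let D be a strongly connected semicomplete multipartite digraph with a G-cycle factor F, and let c' be the number of partite sets of D of size at least 2. Then D has a spanning G-cycle with at least |A(F)| - 2c' arcs; furthermore if c' = 1 then D has a spanning G-cycle with at least |A(F)| - 1 arcs. -/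
open Classical

universe u v

variable {V : Type u} {K : Type v} {A : V → V → Prop} {part : V → K}

/-- The cost of stepping from `a` to `b`: arcs are free, pairs inside a partite set cost `1`,
and all other pairs cost the penalty `N`. -/
noncomputable def stepCost {V : Type u} {K : Type v} (A : V → V → Prop) (part : V → K) (N : ℕ)
    (a b : V) : ℕ :=
  if A a b then 0 else if part a = part b then 1 else N

/-- The sum of `w` over the consecutive pairs of a list. -/
def pathCost {V : Type u} (w : V → V → ℕ) : List V → ℕ
  | [] => 0
  | [_] => 0
  | a :: b :: l => w a b + pathCost w (b :: l)

/-- The sum of `w` over the cyclically consecutive pairs of a list. -/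
def cycleCost {V : Type u} (w : V → V → ℕ) : List V → ℕ
  | [] => 0
  | a :: l => pathCost w (a :: l ++ [a])

/-- `v` follows `u` in the cyclic list `C`. -/
def CyclicNext {V : Type u} (C : List V) (u v : V) : Prop :=
  ∃ L, L ~r C ∧ L.getLast? = some u ∧ L.head? = some v

section Lists

variable {V : Type u} {w : V → V → ℕ}

theorem pathCost_append {l m : List V} {a b : V} (ha : l.getLast? = some a)
    (hb : m.head? = some b) :
    pathCost w (l ++ m) = pathCost w l + w a b + pathCost w m := by
  obtain ⟨m', rfl⟩ : ∃ m', m = b :: m' := by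
    cases m with
    | nil => simp at hb
    | cons x m' => simp at hb; exact ⟨m', by rw [hb]⟩
  induction l with
  | nil => simp at ha
  | cons x l ih =>
    cases l with
    | nil =>
      simp at ha
      subst ha
      simp [pathCost]
    | cons y l =>
      have := ih (by simpa using ha)
      simp only [List.cons_append, pathCost] at this ⊢
      omega

theorem pathCost_le_append_left (l m : List V) : pathCost w l ≤ pathCost w (l ++ m) := by
  rcases hl : l.getLast? with _ | a
  · simp at hl
    simp [hl, pathCost]
  rcases hm : m.head? with _ | b
  · simp at hm
    simp [hm]
  rw [pathCost_append hl hm]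
  omega

theorem cycleCost_eq {l : List V} {u v : V} (hu : l.getLast? = some u) (hv : l.head? = some v) :
    cycleCost w l = pathCost w l + w u v := by
  cases l with
  | nil => simp at hv
  | cons x l =>
    simp at hv
    subst hv
    rw [cycleCost, pathCost_append hu (b := x) (by simp)]
    simp [pathCost]

theorem cycleCost_append_comm (l m : List V) : cycleCost w (l ++ m) = cycleCost w (m ++ l) := by
  rcases l.eq_nil_or_concat with rfl | ⟨l', a, hl⟩
  · simp
  rcases m.eq_nil_or_concat with rfl | ⟨m', b, hm⟩
  · simp
  obtain ⟨c, hc⟩ : ∃ c, l.head? = some c := Option.isSome_iff_exists.1 (by simp [hl])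
  obtain ⟨d, hd⟩ : ∃ c, m.head? = some c := Option.isSome_iff_exists.1 (by simp [hm])
  have ha : l.getLast? = some a := by simp [hl]
  have hb : m.getLast? = some b := by simp [hm]
  rw [cycleCost_eq (u := b) (v := c) (by simp [hb]) (by simp [hc]),
    cycleCost_eq (u := a) (v := d) (by simp [ha]) (by simp [hd]),
    pathCost_append ha hd, pathCost_append hb hc]
  omega

theorem exists_append_of_isRotated {L C : List V} (h : L ~r C) :
    ∃ l m, C = l ++ m ∧ L = m ++ l := by
  obtain ⟨n, hn⟩ := h.symm
  rw [List.rotate_eq_drop_append_take_mod] at hn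
  exact ⟨_, _, (List.take_append_drop (n % C.length) C).symm, hn.symm⟩

theorem cycleCost_isRotated {L C : List V} (h : L ~r C) : cycleCost w L = cycleCost w C := by
  obtain ⟨l, m, rfl, rfl⟩ := exists_append_of_isRotated h
  exact cycleCost_append_comm m l

theorem pathCost_le_cycleCost (l : List V) : pathCost w l ≤ cycleCost w l := by
  cases l with
  | nil => simp [pathCost]
  | cons a l => exact pathCost_le_append_left (a :: l) [a]

theorem cyclicNext_of_infix {L C : List V} (h : L ~r C) {u v : V} (huv : [u, v] <:+: L) :
    CyclicNext C u v := by
  obtain ⟨s, t, rfl⟩ := huv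
  refine ⟨v :: t ++ (s ++ [u]), ?_, by rw [List.getLast?_append]; simp, by simp⟩
  refine List.IsRotated.trans ?_ h
  have := List.isRotated_append (l := v :: t) (l' := s ++ [u])
  simpa using this

theorem infix_of_cyclicNext {L C : List V} (h : L ~r C) {u v : V} (huv : CyclicNext C u v)
    (hv : L.head? ≠ some v) : [u, v] <:+: L := by
  obtain ⟨M, hM, hMu, hMv⟩ := huv
  obtain ⟨l, m, rfl, rfl⟩ := exists_append_of_isRotated (h.trans hM.symm)
  rcases l.eq_nil_or_concat with rfl | ⟨l', a, hl⟩
  · simp at hMv hv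
    exact absurd hMv hv
  rcases m.eq_nil_or_concat with rfl | ⟨m', b, hm⟩
  · simp at hMv hv
    exact absurd hMv hv
  cases l with
  | nil => simp at hl
  | cons c l =>
    simp at hMv
    subst hMv hm
    rw [List.getLast?_append] at hMu
    simp at hMu
    subst hMu
    exact ⟨m', l, by simp⟩

theorem exists_cyclicNext {C : List V} {u : V} (hu : u ∈ C) : ∃ v ∈ C, CyclicNext C u v := by
  obtain ⟨s, t, rfl⟩ := List.append_of_mem hu
  have hr : t ++ (s ++ [u]) ~r s ++ u :: t := by
    have := List.isRotated_append (l := t) (l' := s ++ [u])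
    simpa using this
  obtain ⟨v, hv⟩ : ∃ c, (t ++ (s ++ [u])).head? = some c := Option.isSome_iff_exists.1 (by simp)
  exact ⟨v, hr.perm.mem_iff.1 (List.mem_of_head? hv), _, hr, by simp, hv⟩

theorem exists_cyclicPrev {C : List V} {v : V} (hv : v ∈ C) : ∃ u ∈ C, CyclicNext C u v := by
  obtain ⟨s, t, rfl⟩ := List.append_of_mem hv
  have hr : v :: t ++ s ~r s ++ v :: t := List.isRotated_append
  obtain ⟨u, hu⟩ : ∃ c, (v :: t ++ s).getLast? = some c :=
    Option.isSome_iff_exists.1 (by simp)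
  exact ⟨u, hr.perm.mem_iff.1 (List.mem_of_getLast? hu), _, hr, hu, by simp⟩

theorem CyclicNext.mem_right {C : List V} {u v : V} (h : CyclicNext C u v) : v ∈ C := by
  obtain ⟨L, hr, -, hv⟩ := h
  exact hr.perm.mem_iff.1 (List.mem_of_head? hv)

theorem forall_mem_of_cyclicNext {C : List V} {p : V → Prop} {u : V} (hu : u ∈ C) (hpu : p u)
    (hp : ∀ x y, CyclicNext C x y → p x → p y) : ∀ v ∈ C, p v := by
  obtain ⟨s, t, rfl⟩ := List.append_of_mem hu
  have hr : u :: t ++ s ~r s ++ u :: t := List.isRotated_append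
  have key : ∀ m l, u :: t ++ s = u :: l ++ m → ∀ x ∈ u :: l, p x := by
    intro m l
    induction l using List.reverseRecOn generalizing m with
    | nil => intro _ x hx; simp at hx; exact hx ▸ hpu
    | append_singleton l a ih =>
      intro h x hx
      have hl := ih (a :: m) (by simpa using h)
      rw [← List.cons_append, List.mem_append] at hx
      rcases hx with hx | hx
      · exact hl x hx
      · simp at hx
        subst hx
        obtain ⟨l', b, hb⟩ : ∃ l' b, u :: l = l' ++ [b] :=
          ⟨_, _, (List.dropLast_append_getLast (List.cons_ne_nil u l)).symm⟩
        refine hp b x (cyclicNext_of_infix hr ⟨l', m, ?_⟩) (hl b (by simp [hb]))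
        rw [h, ← List.cons_append, hb]
        simp
  intro v hv
  exact key [] (t ++ s) (by simp) v (by simpa using hr.perm.mem_iff.2 hv)

/-- Split a list at the first element satisfying `p`. -/
theorem exists_split_first {p : V → Prop} {l : List V} (h : ∃ x ∈ l, p x) :
    ∃ s x t, l = s ++ x :: t ∧ p x ∧ ∀ y ∈ s, ¬ p y := by
  induction l with
  | nil => simp at h
  | cons a l ih =>
    by_cases ha : p a
    · exact ⟨[], a, l, by simp, ha, by simp⟩
    · obtain ⟨s, x, t, rfl, hx, hs⟩ := ih (by simpa [ha] using h)
      exact ⟨a :: s, x, t, by simp, hx, by simpa [ha] using hs⟩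

/-- Split a list at the last element satisfying `p`. -/
theorem exists_split_last {p : V → Prop} {l : List V} (h : ∃ x ∈ l, p x) :
    ∃ s x t, l = s ++ x :: t ∧ p x ∧ ∀ y ∈ t, ¬ p y := by
  obtain ⟨s, x, t, hl, hx, hs⟩ := exists_split_first (l := l.reverse) (p := p) (by simpa using h)
  refine ⟨t.reverse, x, s.reverse, ?_, hx, by simpa using hs⟩
  rw [← l.reverse_reverse, hl]
  simp

/-- Multi-insertion: if every element `b` of `X` closes a sublist that fits, at no extra cost,
between two consecutive elements of `L`, then all of `X` can be inserted into `L`. -/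
theorem exists_insert {A : V → V → Prop} (hw : ∀ a b, A a b → w a b = 0) (L : List V) :
    ∀ (n : ℕ) (X : List V), X.length = n →
    (∀ Y b Z, X = Y ++ b :: Z →
      ∃ u v, [u, v] <:+: L ∧ w b v ≤ w u v ∧ ∃ y ∈ Y ++ [b], A u y) →
    ∃ L', L'.Perm (L ++ X) ∧ L'.head? = L.head? ∧ L'.getLast? = L.getLast? ∧
      pathCost w L' ≤ pathCost w L + pathCost w X ∧
      ∀ p q, [p, q] <:+: L → (∀ x ∈ X, ¬ A p x) → [p, q] <:+: L' := by
  intro n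
  induction n using Nat.strong_induction_on with
  | _ n ih =>
  intro X hn hX
  rcases X.eq_nil_or_concat with rfl | ⟨Y, b, hXb⟩
  · exact ⟨L, by simp, rfl, rfl, by simp, fun p q h _ => h⟩
  rw [List.concat_eq_append] at hXb
  subst hXb
  obtain ⟨u, v, huv, hwb, hy⟩ := hX Y b [] rfl
  obtain ⟨S, z, T, hST, hz, hS⟩ := exists_split_first hy
  rw [hST] at hn hX ⊢
  obtain ⟨L', hperm, hhead, hlast, hcost, hkeep⟩ := ih S.length (by simp at hn; omega) S rfl (by
    intro Y' b' Z' h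
    exact hX Y' b' (Z' ++ z :: T) (by simp [h]))
  obtain ⟨l, m, hl⟩ := hkeep u v huv hS
  have hlastX : (z :: T).getLast? = some b := by
    have : (S ++ z :: T).getLast? = some b := by rw [← hST]; simp
    simpa using this
  refine ⟨l ++ [u] ++ ((z :: T) ++ (v :: m)), ?_, ?_, ?_, ?_, ?_⟩
  · have h1 : (l ++ [u] ++ ((z :: T) ++ (v :: m))).Perm (l ++ [u, v] ++ m ++ (z :: T)) := by
      have : ((z :: T) ++ (v :: m)).Perm ((v :: m) ++ (z :: T)) := List.perm_append_comm
      simpa using this.append_left (l ++ [u])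
    refine h1.trans ?_
    rw [hl]
    simpa using hperm.append_right (z :: T)
  · rw [← hhead, ← hl]
    cases l <;> simp
  · obtain ⟨c, hc⟩ : ∃ c, (v :: m).getLast? = some c := Option.isSome_iff_exists.1 (by simp)
    have h2 : l ++ [u, v] ++ m = l ++ [u] ++ (v :: m) := by simp
    rw [← hlast, ← hl, h2]
    simp only [List.getLast?_append, hc, Option.some_or]
  · have e1 : pathCost w (l ++ [u] ++ ((z :: T) ++ (v :: m))) = pathCost w (l ++ [u]) + w u z +
        (pathCost w (z :: T) + w b v + pathCost w (v :: m)) := by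
      rw [pathCost_append (a := u) (b := z) (by simp) (by simp),
        pathCost_append (m := v :: m) hlastX (b := v) (by simp)]
    have e2 : pathCost w L' = pathCost w (l ++ [u]) + w u v + pathCost w (v :: m) := by
      rw [← hl, ← pathCost_append (a := u) (b := v) (by simp) (by simp)]
      simp
    have e3 : pathCost w S + pathCost w (z :: T) ≤ pathCost w (S ++ z :: T) := by
      rcases hS' : S.getLast? with _ | c
      · simp at hS'
        simp [hS', pathCost]
      · rw [pathCost_append hS' (b := z) (by simp)]
        omega
    have := hw u z hz
    omega
  · intro p q hpq hp
    have hpu : p ≠ u := by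
      rintro rfl
      exact hp z (by simp) hz
    obtain ⟨s, t, hst⟩ := hkeep p q hpq fun x hx => hp x (by simp [hx])
    rw [← hl] at hst
    simp only [List.append_assoc, List.cons_append, List.nil_append] at hst
    rcases List.append_eq_append_iff.1 hst with ⟨a', h1, h2⟩ | ⟨c', h1, h2⟩
    · rcases a' with _ | ⟨x, a'⟩
      · simp at h2; exact absurd h2.1 hpu
      rcases a' with _ | ⟨y, a'⟩
      · simp at h2
        obtain ⟨rfl, rfl, rfl⟩ := h2
        exact ⟨s, z :: T ++ v :: m, by simp [h1]⟩
      · simp at h2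
        obtain ⟨rfl, rfl, rfl⟩ := h2
        exact ⟨s, a' ++ u :: z :: T ++ v :: m, by simp [h1]⟩
    · rcases c' with _ | ⟨x, c'⟩
      · simp at h2; exact absurd h2.1.symm hpu
      rcases c' with _ | ⟨y, c'⟩
      · simp at h2
        obtain ⟨rfl, rfl, rfl⟩ := h2
        exact ⟨l ++ u :: z :: T, t, by simp⟩
      · simp at h2
        obtain ⟨rfl, rfl, rfl⟩ := h2
        exact ⟨l ++ u :: z :: T ++ v :: c', t, by simp⟩

end Lists

section Merge

variable {V : Type u} {K : Type v} {A : V → V → Prop} {part : V → K} {w : V → V → ℕ}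

/-- A path and a cycle merge into a path on the union of their vertices at no extra cost. -/
theorem exists_path_merge (hnot : ∀ a b, part a = part b → ¬ A a b)
    (hadj : ∀ a b, part a ≠ part b → A a b ∨ A b a) (hA : ∀ a b, A a b → w a b = 0)
    (hpart : ∀ a b, part a = part b → w a b = 1) (P C : List V) :
    ∃ Q, Q.Perm (P ++ C) ∧ pathCost w Q ≤ pathCost w P + cycleCost w C := by
  rcases C.eq_nil_or_concat with rfl | ⟨C', c₀, hC'⟩
  · exact ⟨P, by simp, by simp [cycleCost]⟩
  have hc₀ : c₀ ∈ C := by simp [hC']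
  clear hC' C'
  by_contra! hno
  have hstart : ∀ b X, P = b :: X → ∀ u v, CyclicNext C u v → w u v < w u b := by
    rintro b X rfl u v ⟨L, hr, hu, hv⟩
    have := hno (L ++ (b :: X)) ((hr.perm.append_right _).trans List.perm_append_comm)
    rw [pathCost_append hu (b := b) (by simp), ← cycleCost_isRotated hr, cycleCost_eq hu hv] at this
    omega
  have hend : ∀ Y a, P = Y ++ [a] → ∀ u v, CyclicNext C u v → w u v < w a v := by
    rintro Y a rfl u v ⟨L, hr, hu, hv⟩
    have := hno (Y ++ [a] ++ L) (hr.perm.append_left _)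
    rw [pathCost_append (a := a) (by simp) hv, ← cycleCost_isRotated hr, cycleCost_eq hu hv] at this
    omega
  have hmid : ∀ Y a b X, P = Y ++ a :: b :: X → ∀ u v, CyclicNext C u v →
      w a b + w u v < w a v + w u b := by
    rintro Y a b X rfl u v ⟨L, hr, hu, hv⟩
    have := hno (Y ++ [a] ++ (L ++ (b :: X))) (by
      have : (L ++ (b :: X)).Perm (b :: X ++ C) :=
        (hr.perm.append_right _).trans List.perm_append_comm
      simpa using this.append_left (Y ++ [a]))
    have e : pathCost w (Y ++ a :: b :: X) = pathCost w (Y ++ [a]) + w a b + pathCost w (b :: X) := by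
      rw [← pathCost_append (by simp) (by simp)]
      simp
    have hh : (L ++ (b :: X)).head? = some v := by simp [hv]
    rw [pathCost_append (a := a) (by simp) hh, pathCost_append hu (b := b) (by simp),
      ← cycleCost_isRotated hr, cycleCost_eq hu hv, e] at this
    omega
  have hP : P ≠ [] := by
    rintro rfl
    have := hno C (by simp)
    have := pathCost_le_cycleCost (w := w) C
    omega
  -- the last vertex of `P` without in-neighbours on `C`
  obtain ⟨X₀, k, X, rfl, hk, hX⟩ : ∃ s x t, P = s ++ x :: t ∧ (∀ u ∈ C, ¬ A u x) ∧
      ∀ y ∈ t, ¬ ∀ u ∈ C, ¬ A u y := by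
    refine exists_split_last ?_
    obtain ⟨b, X, hb⟩ := List.exists_cons_of_ne_nil hP
    refine ⟨b, by simp [hb], fun u hu hub => ?_⟩
    obtain ⟨v, -, huv⟩ := exists_cyclicNext hu
    have := hstart b X hb u v huv
    rw [hA _ _ hub] at this
    omega
  -- a vertex at the end of `P` is dominated by or in the same partite set as each vertex of `C`
  have hendA : ∀ Y a, X₀ ++ k :: X = Y ++ [a] → ∀ u v, CyclicNext C u v →
      A v a ∨ (part v = part a ∧ part u ≠ part v) := by
    intro Y a ha u v huv
    have h := hend Y a ha u v huv
    by_cases hva : part v = part a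
    · refine Or.inr ⟨hva, fun huv' => ?_⟩
      rw [hpart _ _ huv', hpart _ _ hva.symm] at h
      omega
    · rcases hadj _ _ hva with h' | h'
      · exact Or.inl h'
      · rw [hA _ _ h'] at h
        omega
  have hXne : X ≠ [] := by
    rintro rfl
    obtain ⟨v, hv, hv1⟩ := exists_cyclicNext hc₀
    obtain ⟨v', hv', hv2⟩ := exists_cyclicNext hv
    rcases hendA X₀ k rfl _ _ hv1 with h | ⟨h, -⟩
    · exact hk _ hv h
    rcases hendA X₀ k rfl _ _ hv2 with h₁ | ⟨h₁, h₂⟩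
    · exact hk _ hv' h₁
    · exact h₂ (h.trans h₁.symm)
  -- `C` is not contained in the partite set of `k`
  have hCK : ¬ ∀ c ∈ C, part c = part k := by
    intro hall
    obtain ⟨y, X', rfl⟩ := List.exists_cons_of_ne_nil hXne
    have := hX y (by simp)
    push Not at this
    obtain ⟨u, hu, huy⟩ := this
    obtain ⟨v, hv, huv⟩ := exists_cyclicNext hu
    have := hmid X₀ k y X' rfl u v huv
    rw [hA _ _ huy, hpart _ _ ((hall u hu).trans (hall v hv).symm),
      hpart _ _ (hall v hv).symm] at this
    omega
  -- consecutive vertices of `P`, the second one in the partite set of `k`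
  have hpair : ∀ Y b Z, X = Y ++ b :: Z → part b = part k →
      (∀ y ∈ Y, ∀ u v, CyclicNext C u v → A u y → part v = part k) →
      ∀ u v, CyclicNext C u v → A u b → part v = part k →
      ∃ Y' y v', Y = Y' ++ [y] ∧ A v y ∧ CyclicNext C v v' ∧ part v' = part k := by
    intro Y b Z hXe hb hY u v huv hub hv
    obtain ⟨v', -, hvv'⟩ := exists_cyclicNext huv.mem_right
    rcases Y.eq_nil_or_concat with rfl | ⟨Y', y, rfl⟩
    · have := hmid X₀ k b Z (by simp [hXe]) u v huv
      rw [hA _ _ hub, hpart _ _ hb.symm, hpart _ _ hv.symm] at this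
      omega
    simp only [List.concat_eq_append] at *
    have h := hmid (X₀ ++ k :: Y') y b Z (by simp [hXe]) u v huv
    rw [hA _ _ hub] at h
    have hne : part v ≠ part y := by
      intro hvy
      rw [hpart _ _ hvy.symm, hpart y b (by rw [← hvy, hv, hb])] at h
      omega
    have hvy : A v y := by
      rcases hadj _ _ hne with h' | h'
      · exact h'
      · rw [hA _ _ h'] at h
        omega
    exact ⟨Y', y, v', rfl, hvy, hvv', hY y (by simp) v v' hvv' hvy⟩
  by_cases hl : ∃ x ∈ X, ∃ u v, CyclicNext C u v ∧ A u x ∧ part v ≠ part k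
  · obtain ⟨Y, l, Z, rfl, ⟨u, v, huv, hul, hv⟩, hY⟩ := exists_split_first hl
    have hY' : ∀ y ∈ Y, ∀ u v, CyclicNext C u v → A u y → part v = part k := by
      intro y hy u v huv huy
      by_contra hc
      exact hY y hy ⟨u, v, huv, huy, hc⟩
    have huv' := huv
    obtain ⟨L, hr, hLu, hLv⟩ := huv'
    have hlin : ∀ p q, CyclicNext C p q → part q = part k → [p, q] <:+: L := by
      intro p q hpq hq
      refine infix_of_cyclicNext hr hpq ?_
      rw [hLv]
      rintro h
      cases h
      exact hv hq
    obtain ⟨L', hperm, hhead, hlast, hcost, -⟩ := exists_insert hA L Y.length Y rfl (by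
      intro Y₁ b Y₂ hYe
      have hb := hX b (by simp [hYe])
      push Not at hb
      obtain ⟨p, hp, hpb⟩ := hb
      have hbY : b ∈ Y := by simp [hYe]
      by_cases hbk : part b = part k
      · obtain ⟨q, -, hpq⟩ := exists_cyclicNext hp
        have hq := hY' b hbY p q hpq hpb
        obtain ⟨Y', y, q', rfl, hqy, hqq', hq'⟩ := hpair Y₁ b (Y₂ ++ l :: Z) (by simp [hYe]) hbk
          (fun y hy => hY' y (by simp [hYe, hy])) p q hpq hpb hq
        refine ⟨q, q', hlin _ _ hqq' hq', ?_, y, by simp, hqy⟩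
        rw [hpart _ _ (hbk.trans hq'.symm), hpart _ _ (hq.trans hq'.symm)]
      · obtain ⟨p, q, hpq, hpb, hqb⟩ : ∃ p q, CyclicNext C p q ∧ A p b ∧ ¬ A q b := by
          by_contra! hcon
          have hall := forall_mem_of_cyclicNext (p := fun x => A x b) hp hpb
            fun x y hxy hx => hcon x y hxy hx
          refine hCK fun c hc => ?_
          obtain ⟨d, hd, hdc⟩ := exists_cyclicPrev hc
          exact hY' b hbY d c hdc (hall d hd)
        have hq := hY' b hbY p q hpq hpb
        refine ⟨p, q, hlin _ _ hpq hq, ?_, b, by simp, hpb⟩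
        rw [hA b q ((hadj q b (by rw [hq]; exact Ne.symm hbk)).resolve_left hqb)]
        omega)
    have hkv : A k v := (hadj k v (Ne.symm hv)).resolve_right (hk v huv.mem_right)
    have h := hno (X₀ ++ [k] ++ (L' ++ (l :: Z))) (by
      have h1 : (L' ++ (l :: Z)).Perm (Y ++ l :: Z ++ C) := by
        have h2 : L'.Perm (Y ++ C) :=
          hperm.trans ((hr.perm.append_right Y).trans List.perm_append_comm)
        refine (h2.append_right (l :: Z)).trans ?_
        rw [List.append_assoc, List.append_assoc]
        exact List.Perm.append_left Y List.perm_append_comm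
      simpa using h1.append_left (X₀ ++ [k]))
    have hh : (L' ++ (l :: Z)).head? = some v := by simp [hhead, hLv]
    rw [pathCost_append (a := k) (by simp) hh,
      pathCost_append (hlast.trans hLu) (b := l) (by simp), hA _ _ hkv, hA _ _ hul,
      ← cycleCost_isRotated hr, cycleCost_eq hLu hLv] at h
    have e : pathCost w (X₀ ++ [k]) + (pathCost w Y + pathCost w (l :: Z)) ≤
        pathCost w (X₀ ++ k :: (Y ++ l :: Z)) := by
      have e1 : X₀ ++ k :: (Y ++ l :: Z) = X₀ ++ [k] ++ (Y ++ l :: Z) := by simp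
      obtain ⟨z, hz⟩ : ∃ z, (Y ++ l :: Z).head? = some z :=
        Option.isSome_iff_exists.1 (by simp)
      rw [e1, pathCost_append (a := k) (by simp) hz]
      rcases hYl : Y.getLast? with _ | c
      · simp at hYl
        simp [hYl, pathCost]
      · rw [pathCost_append hYl (b := l) (by simp)]
        omega
    omega
  · have hl' : ∀ x ∈ X, ∀ u v, CyclicNext C u v → A u x → part v = part k := by
      intro x hx u v huv hux
      by_contra hc
      exact hl ⟨x, hx, u, v, huv, hux, hc⟩
    rcases X.eq_nil_or_concat with h | ⟨Y, r, hXr⟩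
    · exact hXne h
    rw [List.concat_eq_append] at hXr
    have hr := hendA (X₀ ++ k :: Y) r (by simp [hXr])
    by_cases hrk : part r = part k
    · obtain ⟨c, hc, hck⟩ : ∃ c ∈ C, part c ≠ part k := by simpa using hCK
      obtain ⟨b, -, hbc⟩ := exists_cyclicPrev hc
      obtain ⟨d, -, hcd⟩ := exists_cyclicNext hc
      have hcr : A c r := (hr b c hbc).resolve_right fun h => hck (h.1.trans hrk)
      have hd := hl' r (by simp [hXr]) c d hcd hcr
      obtain ⟨Y', y, e, -, -, hde, he⟩ := hpair Y r [] hXr hrk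
        (fun y hy => hl' y (by simp [hXr, hy])) c d hcd hcr hd
      rcases hr d e hde with h | h
      · exact hnot _ _ (he.trans hrk.symm) h
      · exact h.2 (hd.trans he.symm)
    · have hall : ∀ c ∈ C, A c r := by
        intro c hc
        obtain ⟨b, hb, hbc⟩ := exists_cyclicPrev hc
        obtain ⟨a, -, hab⟩ := exists_cyclicPrev hb
        rcases hr b c hbc with h | ⟨h1, h2⟩
        · exact h
        rcases hr a b hab with h' | h'
        · exact absurd (h1.symm.trans (hl' r (by simp [hXr]) b c hbc h')) hrk
        · exact absurd (h'.1.trans h1.symm) h2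
      refine hCK fun c hc => ?_
      obtain ⟨b, hb, hbc⟩ := exists_cyclicPrev hc
      exact hl' r (by simp [hXr]) b c hbc (hall b hb)

end Merge

section Closing

variable {V : Type u} {K : Type v} {A : V → V → Prop} {part : V → K} {w : V → V → ℕ}

theorem exists_arc_of_isStrong (hs : ∀ x y : V, Relation.ReflTransGen A x y) {S : Set V}
    {a b : V} (ha : a ∉ S) (hb : b ∈ S) : ∃ x y, x ∉ S ∧ y ∈ S ∧ A x y := by
  by_contra! h
  have key : ∀ c, Relation.ReflTransGen A a c → c ∉ S := by
    intro c hc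
    induction hc with
    | refl => exact ha
    | tail _ h1 ih => exact fun h2 => h _ _ ih h2 h1
  exact key b (hs a b) hb

/-- Extend a cycle on an initial segment of a spanning path `Pre ++ Suf` to a spanning cycle,
inserting the rest of the path piece by piece. The set `U` holds the partite sets inside of which
a closing step has been made; these do not occur in `Suf`. -/
theorem exists_cycle_extend [Fintype V]
    (hadj : ∀ a b, part a ≠ part b → A a b ∨ A b a) (hA : ∀ a b, A a b → w a b = 0)
    (hpart : ∀ a b, part a = part b → w a b = 1)
    (hs : ∀ x y : V, Relation.ReflTransGen A x y) (r : V → ℕ) (hr : Function.Injective r)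
    (T : Finset K) (hT : ∀ a b, a ≠ b → part a = part b → part a ∈ T) :
    ∀ (n : ℕ) (Pre Suf : List V) (a : V) (H : List V) (U : Finset K), Suf.length = n →
      (Pre ++ Suf).Pairwise (fun x y => r x < r y) → (∀ x, x ∈ Pre ++ Suf) →
      (a :: H).Perm Pre → (a :: H).IsChain (fun x y => r a < r y → r x < r y) →
      (∀ s ∈ Suf, ∀ x ∈ Pre, r x ≤ r a → ¬ A s x ∧ part s ≠ part x) →
      U ⊆ T → (∀ s ∈ Suf, part s ∉ U) → cycleCost w (a :: H) ≤ pathCost w Pre + U.card →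
      ∃ C, C.Perm (Pre ++ Suf) ∧ cycleCost w C ≤ pathCost w (Pre ++ Suf) + T.card := by
  intro n
  induction n using Nat.strong_induction_on with
  | _ n ih =>
  intro Pre Suf a H U hn hsort hall hperm hchain hlink hUT hU hcost
  rcases Suf.eq_nil_or_concat with rfl | ⟨Suf₀, z, hz⟩
  · have := Finset.card_le_card hUT
    exact ⟨a :: H, by simpa using hperm, by simp; omega⟩
  have hzS : z ∈ Suf := by simp [hz]
  clear hz Suf₀
  have hlt : ∀ x ∈ Pre, ∀ s ∈ Suf, r x < r s := (List.pairwise_append.1 hsort).2.2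
  have haP : a ∈ Pre := hperm.mem_iff.1 (by simp)
  -- the first vertex of `Pre` that receives a closing step from `Suf`
  obtain ⟨b, ⟨hbP, hb⟩, hbmin⟩ : ∃ b, (b ∈ Pre ∧ ∃ s ∈ Suf, A s b ∨ part s = part b) ∧
      ∀ x ∈ Pre, r x < r b → ∀ s ∈ Suf, ¬ (A s x ∨ part s = part x) := by
    obtain ⟨s, x, hs', hx, hsx⟩ := exists_arc_of_isStrong hs (S := {x | x ∈ Pre}) (a := z) (b := a)
      (fun h => absurd (hlt z h z hzS) (lt_irrefl _)) haP
    have hne : (Finset.univ.filter fun x => x ∈ Pre ∧ ∃ s ∈ Suf, A s x ∨ part s = part x).Nonempty :=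
      ⟨x, by
        simp only [Finset.mem_filter, Finset.mem_univ, true_and]
        exact ⟨hx, s, ((List.mem_append.1 (hall s)).resolve_left hs'), Or.inl hsx⟩⟩
    obtain ⟨b, hb, hmin⟩ := Finset.exists_min_image _ r hne
    refine ⟨b, (Finset.mem_filter.1 hb).2, fun x hx hxb s hs hl => ?_⟩
    exact absurd (hmin x (by simp only [Finset.mem_filter, Finset.mem_univ, true_and]; exact ⟨hx, s, hs, hl⟩)) (not_le.2 hxb)
  have hab : r a < r b := by
    by_contra! h
    obtain ⟨s, hs', hl⟩ := hb
    have := hlink s hs' b hbP h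
    tauto
  have hbH : b ∈ H := by
    rcases List.mem_cons.1 (hperm.mem_iff.2 hbP) with rfl | h
    · exact absurd hab (lt_irrefl _)
    · exact h
  obtain ⟨H₁, H₂, rfl⟩ := List.append_of_mem hbH
  obtain ⟨S, t, R, rfl, ht, hR⟩ := exists_split_last hb
  -- the new cycle
  obtain ⟨q, hq⟩ : ∃ q, (a :: H₁).getLast? = some q := Option.isSome_iff_exists.1 (by simp)
  obtain ⟨s, hsS⟩ : ∃ s, (S ++ [t]).head? = some s := Option.isSome_iff_exists.1 (by simp)
  obtain ⟨p, hp⟩ : ∃ p, (b :: H₂).getLast? = some p := Option.isSome_iff_exists.1 (by simp)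
  have hqP : q ∈ Pre := hperm.mem_iff.1 (by
    have := List.mem_of_getLast? hq
    rw [← List.cons_append]
    exact List.mem_append_left _ this)
  have hsSuf : s ∈ S ++ t :: R := by
    have := List.mem_of_head? hsS
    simp at this ⊢
    tauto
  have hch : (a :: H₁).IsChain (fun x y => r a < r y → r x < r y) ∧
      (b :: H₂).IsChain (fun x y => r a < r y → r x < r y) ∧ r q < r b := by
    rw [← List.cons_append, List.isChain_append] at hchain
    exact ⟨hchain.1, hchain.2.1, hchain.2.2 q hq b (by simp) hab⟩
  have hwqs : w q s = 0 := by
    have h := hbmin q hqP hch.2.2 s hsSuf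
    push Not at h
    exact hA _ _ ((hadj q s (Ne.symm h.2)).resolve_right h.1)
  have hmono : ∀ x y, (r a < r y → r x < r y) → r b < r y → r x < r y :=
    fun x y h h' => h (hab.trans h')
  have hcyc : cycleCost w (b :: (H₂ ++ (a :: H₁) ++ (S ++ [t]))) ≤
      cycleCost w (a :: (H₁ ++ b :: H₂)) + pathCost w (S ++ [t]) + w t b := by
    have e1 : b :: (H₂ ++ (a :: H₁) ++ (S ++ [t])) = (b :: H₂) ++ ((a :: H₁) ++ (S ++ [t])) := by
      simp
    have e2 : a :: (H₁ ++ b :: H₂) = (a :: H₁) ++ (b :: H₂) := by simp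
    have hlast : (b :: H₂ ++ (a :: H₁ ++ (S ++ [t]))).getLast? = some t := by
      rw [← List.append_assoc, ← List.append_assoc, List.getLast?_append]
      simp
    have hlast' : (a :: H₁ ++ b :: H₂).getLast? = some p := by
      rw [List.getLast?_append, hp, Option.some_or]
    rw [e1, e2, cycleCost_eq hlast (v := b) (by simp), cycleCost_eq hlast' (v := a) (by simp),
      pathCost_append hp (b := a) (by simp), pathCost_append hq hsS,
      pathCost_append hq (b := b) (by simp), hwqs]
    omega
  have hpre : pathCost w Pre + pathCost w (S ++ [t]) ≤ pathCost w (Pre ++ (S ++ [t])) := by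
    obtain ⟨c, hc⟩ : ∃ c, Pre.getLast? = some c :=
      Option.isSome_iff_exists.1 (by simpa using List.ne_nil_of_mem haP)
    rw [pathCost_append hc hsS]
    omega
  have hassoc : Pre ++ (S ++ t :: R) = Pre ++ (S ++ [t]) ++ R := by simp
  obtain ⟨U', hU'T, hU', hcU⟩ : ∃ U' ⊆ T, (∀ s ∈ R, part s ∉ U') ∧ U.card + w t b ≤ U'.card := by
    by_cases htb : A t b
    · exact ⟨U, hUT, fun s hs => hU s (by simp [hs]), by rw [hA _ _ htb]; omega⟩
    · have htb' := ht.resolve_left htb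
      refine ⟨insert (part t) U, ?_, ?_, ?_⟩
      · intro k hk
        rcases Finset.mem_insert.1 hk with rfl | hk
        · exact hT t b (by rintro rfl; exact absurd (hlt t hbP t (by simp)) (lt_irrefl _)) htb'
        · exact hUT hk
      · intro x hx hk
        rcases Finset.mem_insert.1 hk with hk | hk
        · exact hR x hx (Or.inr (hk.trans htb'))
        · exact hU x (by simp [hx]) hk
      · rw [Finset.card_insert_of_notMem (hU t (by simp)), hpart _ _ htb']
  rw [hassoc]
  refine ih R.length (by simp at hn; omega) (Pre ++ (S ++ [t])) R b
    (H₂ ++ (a :: H₁) ++ (S ++ [t])) U' rfl (hassoc ▸ hsort)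
    (hassoc ▸ hall) ?_ ?_ ?_ hU'T hU' (by omega)
  · have h1 : (b :: (H₂ ++ (a :: H₁) ++ (S ++ [t]))).Perm ((a :: (H₁ ++ b :: H₂)) ++ (S ++ [t])) := by
      have : ((b :: H₂) ++ (a :: H₁)).Perm ((a :: H₁) ++ (b :: H₂)) := List.perm_append_comm
      simpa using this.append_right (S ++ [t])
    exact h1.trans (hperm.append_right _)
  · have e1 : b :: (H₂ ++ (a :: H₁) ++ (S ++ [t])) = (b :: H₂) ++ ((a :: H₁) ++ (S ++ [t])) := by
      simp
    rw [e1, List.isChain_append, List.isChain_append]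
    refine ⟨hch.2.1.imp hmono, ⟨hch.1.imp hmono, ?_, ?_⟩, ?_⟩
    · have h1 : (S ++ [t]).Pairwise (fun x y => r x < r y) := by
        rw [hassoc] at hsort
        exact (List.pairwise_append.1 (List.pairwise_append.1 hsort).1).2.1
      exact h1.isChain.imp fun _ _ h _ => h
    · intro x hx y hy _
      rw [hq] at hx
      rw [hsS] at hy
      cases hx
      cases hy
      exact hlt _ hqP _ hsSuf
    · intro x _ y hy h
      simp at hy
      subst hy
      exact absurd h (not_lt.2 hab.le)
  · intro x hx y hy hyb
    have hxSuf : x ∈ S ++ t :: R := by simp [hx]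
    rw [← not_or]
    rcases List.mem_append.1 hy with hy | hy
    · rcases hyb.lt_or_eq with h | h
      · exact hbmin y hy h x hxSuf
      · exact hr h ▸ hR x hx
    · have := hlt b hbP y (by simp at hy ⊢; tauto)
      omega

/-- A spanning path of a strong semicomplete multipartite digraph can be closed to a spanning
cycle at extra cost at most the number of non-trivial partite sets. -/
theorem exists_cycle_of_path [Fintype V] [Nontrivial V]
    (hadj : ∀ a b, part a ≠ part b → A a b ∨ A b a) (hA : ∀ a b, A a b → w a b = 0)
    (hpart : ∀ a b, part a = part b → w a b = 1)
    (hs : ∀ x y : V, Relation.ReflTransGen A x y)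
    (T : Finset K) (hT : ∀ a b, a ≠ b → part a = part b → part a ∈ T)
    {P : List V} (hP : P.Nodup) (hall : ∀ x, x ∈ P) :
    ∃ C, C.Perm P ∧ cycleCost w C ≤ pathCost w P + T.card := by
  obtain ⟨r, hr, hsort⟩ : ∃ r : V → ℕ, Function.Injective r ∧ P.Pairwise fun x y => r x < r y := by
    refine ⟨fun x => P.idxOf x, fun x y h => (List.idxOf_inj (hall x)).1 h, ?_⟩
    rw [List.pairwise_iff_getElem]
    intro i j hi hj hij
    show P.idxOf P[i] < P.idxOf P[j]
    rwa [hP.idxOf_getElem, hP.idxOf_getElem]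
  obtain ⟨p, X, rfl⟩ : ∃ p X, P = p :: X :=
    List.exists_cons_of_ne_nil (List.ne_nil_of_mem (hall (Classical.arbitrary V)))
  have hp := List.nodup_cons.1 hP
  obtain ⟨z, hz⟩ := exists_ne p
  have hX : ∃ x ∈ X, A x p ∨ part x = part p := by
    obtain ⟨x, y, hx, hy, hxy⟩ := exists_arc_of_isStrong hs (S := {p}) (a := z) (b := p)
      (by simpa using hz) rfl
    obtain rfl : y = p := hy
    exact ⟨x, (List.mem_cons.1 (hall x)).resolve_left hx, Or.inl hxy⟩
  obtain ⟨S, t, R, rfl, ht, hR⟩ := exists_split_last hX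
  have htp : t ≠ p := by
    rintro rfl
    exact hp.1 (by simp)
  obtain ⟨U, hUT, hU, hcU⟩ : ∃ U ⊆ T, (∀ s ∈ R, part s ∉ U) ∧ w t p ≤ U.card := by
    by_cases h : A t p
    · exact ⟨∅, by simp, by simp, by rw [hA _ _ h]; omega⟩
    · have h' := ht.resolve_left h
      refine ⟨{part p}, ?_, ?_, by rw [hpart _ _ h']; simp⟩
      · rw [Finset.singleton_subset_iff]
        exact hT p t htp.symm h'.symm
      · intro x hx hk
        exact hR x hx (Or.inr (Finset.mem_singleton.1 hk))
  have e : p :: (S ++ t :: R) = p :: (S ++ [t]) ++ R := by simp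
  rw [e] at hsort hall ⊢
  refine exists_cycle_extend hadj hA hpart hs _ hr T hT R.length _ R p (S ++ [t]) U rfl hsort hall
    (List.Perm.refl _) ?_ ?_ hUT hU ?_
  · exact (List.pairwise_append.1 hsort).1.isChain.imp fun _ _ h _ => h
  · intro x hx y hy hyp
    obtain rfl : y = p := by
      rcases List.mem_cons.1 hy with h | h
      · exact h
      · have := List.rel_of_pairwise_cons (List.pairwise_append.1 hsort).1 h
        omega
    rw [← not_or]
    exact hR x hx
  · rw [cycleCost_eq (u := t) (v := p) (by rw [← List.cons_append, List.getLast?_append]; simp)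
      (by simp)]
    omega

end Closing

section Factor

variable {V : Type u} {K : Type v} {A : V → V → Prop} {part : V → K} {w : V → V → ℕ}

theorem pathCost_eq_sum (l : List V) :
    pathCost w l = ((l.zip l.tail).map fun q => w q.1 q.2).sum := by
  induction l with
  | nil => rfl
  | cons a l ih =>
    cases l with
    | nil => rfl
    | cons b l => simpa [pathCost] using ih

theorem zip_rotate_one (a : V) (l : List V) :
    (a :: l).zip ((a :: l).rotate 1) = (a :: l ++ [a]).zip (a :: l ++ [a]).tail := by
  have := List.zip_append (l₁ := a :: l) (r₁ := [a]) (l₂ := l ++ [a]) (r₂ := []) (by simp)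
  simpa using this.symm

theorem rel_of_mem_zip_tail {R : V → V → Prop} {l : List V} (h : l.IsChain R) :
    ∀ q ∈ l.zip l.tail, R q.1 q.2 := by
  induction h with
  | nil => simp
  | singleton a => simp
  | cons_cons hab _ ih => simpa [hab] using ih

theorem isChain_of_pathCost_lt {N : ℕ} {l : List V} (h : pathCost (stepCost A part N) l < N) :
    l.IsChain fun a b => A a b ∨ part a = part b := by
  induction l with
  | nil => exact .nil
  | cons a l ih =>
    cases l with
    | nil => exact .singleton a
    | cons b l =>
      rw [pathCost] at h
      refine .cons_cons ?_ (ih (by omega))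
      by_contra! hc
      simp only [stepCost, hc.1, hc.2, if_false] at h
      omega

theorem countP_add_sum_stepCost (hnot : ∀ a b, part a = part b → ¬ A a b) (N : ℕ)
    (l : List (V × V)) (hl : ∀ q ∈ l, A q.1 q.2 ∨ part q.1 = part q.2) :
    (l.countP fun q => decide (A q.1 q.2)) + (l.map fun q => stepCost A part N q.1 q.2).sum =
      l.length := by
  induction l with
  | nil => rfl
  | cons q l ih =>
    have := ih fun x hx => hl x (by simp [hx])
    rcases hl q (by simp) with h | h
    · simp [h, stepCost] at this ⊢
      omega
    · simp [h, hnot _ _ h, stepCost] at this ⊢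
      omega

theorem GCycle.len_add_cycleCost (hnot : ∀ a b, part a = part b → ¬ A a b) (N : ℕ)
    (C : GCycle A part) :
    C.len + cycleCost (stepCost A part N) C.verts = C.verts.length := by
  obtain ⟨⟨l, hne, hnd, hchain⟩, hclose⟩ := C
  cases l with
  | nil => exact absurd rfl hne
  | cons a l =>
    have hall : (a :: l ++ [a]).IsChain fun x y => A x y ∨ part x = part y := by
      rw [List.isChain_append]
      refine ⟨hchain, .singleton a, fun x hx y hy => ?_⟩
      rw [List.getLast?_eq_some_getLast hne] at hx
      cases hx
      cases hy
      exact hclose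
    have := countP_add_sum_stepCost hnot N _ (rel_of_mem_zip_tail hall)
    rw [← pathCost_eq_sum] at this
    simp only [GCycle.len, cycleCost, zip_rotate_one]
    rw [this]
    simp

/-- A list without repetitions whose cyclic cost is less than the penalty is a G-cycle. -/
theorem exists_gCycle_of_cycleCost_lt {N : ℕ} {l : List V} (hne : l ≠ []) (hl : l.Nodup)
    (h : cycleCost (stepCost A part N) l < N) : ∃ C : GCycle A part, C.verts = l := by
  cases l with
  | nil => exact absurd rfl hne
  | cons a l =>
    have hall := isChain_of_pathCost_lt h
    rw [List.isChain_append] at hall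
    exact ⟨⟨⟨a :: l, hne, hl, hall.1⟩,
      hall.2.2 _ (List.getLast?_eq_some_getLast hne) a (by simp)⟩, rfl⟩

/-- Any list of cycles merges into a path at no extra cost. -/
theorem exists_path_flatten (hnot : ∀ a b, part a = part b → ¬ A a b)
    (hadj : ∀ a b, part a ≠ part b → A a b ∨ A b a) (hA : ∀ a b, A a b → w a b = 0)
    (hpart : ∀ a b, part a = part b → w a b = 1) (L : List (List V)) :
    ∃ P, P.Perm L.flatten ∧ pathCost w P ≤ (L.map (cycleCost w)).sum := by
  induction L with
  | nil => exact ⟨[], by simp, by simp [pathCost]⟩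
  | cons C L ih =>
    obtain ⟨P, hP, hcost⟩ := ih
    obtain ⟨Q, hQ, hQcost⟩ := exists_path_merge hnot hadj hA hpart P C
    refine ⟨Q, ?_, ?_⟩
    · rw [List.flatten_cons]
      exact hQ.trans ((hP.append_right C).trans List.perm_append_comm)
    · rw [List.map_cons, List.sum_cons]
      omega

theorem arcs_add_sum_cycleCost (hnot : ∀ a b, part a = part b → ¬ A a b) (N : ℕ)
    (L : List (GCycle A part)) :
    (L.map GCycle.len).sum +
      ((L.map fun C => C.verts).map (cycleCost (stepCost A part N))).sum =
      (L.map fun C => C.verts).flatten.length := by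
  induction L with
  | nil => rfl
  | cons C L ih =>
    have := C.len_add_cycleCost hnot N
    simp only [List.map_cons, List.sum_cons, List.flatten_cons, List.length_append]
    omega

/-- The spanning G-cycle obtained from a G-cycle factor loses at most one arc for each
non-trivial partite set. -/
theorem exists_spanning_gCycle [Fintype V] [Nonempty V] (hSMD : IsSMD A part) (hstrong : IsStrong A)
    (F : GCSub A part) (hF : F.IsFactor) (T : Finset K)
    (hT : ∀ a b, a ≠ b → part a = part b → part a ∈ T) :
    ∃ C : GCycle A part, (∀ v : V, v ∈ C.verts) ∧ F.arcs ≤ C.len + T.card := by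
  rcases subsingleton_or_nontrivial V with hV | hV
  · obtain ⟨C, hC, hv⟩ := hF (Classical.arbitrary V)
    refine ⟨C, fun v => Subsingleton.elim (Classical.arbitrary V) v ▸ hv, ?_⟩
    have : F.arcs = 0 := by
      refine List.sum_eq_zero fun n hn => ?_
      obtain ⟨D, -, rfl⟩ := List.mem_map.1 hn
      refine List.countP_eq_zero.2 fun q _ => ?_
      simpa using hSMD.noInside q.1 q.2 (by rw [Subsingleton.elim q.1 q.2])
    omega
  set L := F.cycles.map fun C => C.verts with hL
  obtain ⟨N, hN⟩ : ∃ N, N = L.flatten.length + T.card + 1 := ⟨_, rfl⟩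
  have hA : ∀ a b, A a b → stepCost A part N a b = 0 := fun a b h => by simp [stepCost, h]
  have hpart : ∀ a b, part a = part b → stepCost A part N a b = 1 := fun a b h => by
    simp [stepCost, h, hSMD.noInside a b h]
  obtain ⟨P, hP, hPcost⟩ := exists_path_flatten hSMD.noInside hSMD.adj hA hpart L
  have hsum : F.arcs + _ = L.flatten.length :=
    arcs_add_sum_cycleCost hSMD.noInside N F.cycles
  rw [← hL] at hsum
  have hnd : L.flatten.Nodup := by
    rw [List.nodup_flatten]
    refine ⟨fun l hl => ?_, ?_⟩
    · obtain ⟨C, -, rfl⟩ := List.mem_map.1 hl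
      exact C.nodup
    · rw [hL, List.pairwise_map]
      exact F.disj.imp fun h x hx hx' => h x hx hx'
  have hall : ∀ v, v ∈ L.flatten := by
    intro v
    obtain ⟨C, hC, hv⟩ := hF v
    exact List.mem_flatten.2 ⟨_, List.mem_map.2 ⟨C, hC, rfl⟩, hv⟩
  obtain ⟨l, hl, hlcost⟩ := exists_cycle_of_path hSMD.adj hA hpart hstrong T hT
    (hP.nodup_iff.2 hnd) fun x => hP.mem_iff.2 (hall x)
  have hlP := hl.trans hP
  obtain ⟨C, rfl⟩ := exists_gCycle_of_cycleCost_lt (A := A) (part := part) (N := N) (l := l)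
    (List.ne_nil_of_mem (hlP.mem_iff.2 (hall (Classical.arbitrary V)))) (hlP.nodup_iff.2 hnd)
    (by omega)
  refine ⟨C, fun v => hlP.mem_iff.2 (hall v), ?_⟩
  have h1 := C.len_add_cycleCost hSMD.noInside N
  have h2 := hlP.length_eq
  omega

end Factor

/-- A strongly connected semicomplete multipartite digraph with a
G-cycle factor `F` has a spanning G-cycle with at least `|A(F)| - 2c'` arcs, where `c'`
is the number of partite sets with at least two vertices; if `c' = 1` it has a spanning
G-cycle with at least `|A(F)| - 1` arcs. -/
theorem stmt18 {V : Type} {c : ℕ} [Fintype V] [Nonempty V]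
    {A : V → V → Prop} {part : V → Fin c}
    (hSMD : IsSMD A part) (hstrong : IsStrong A)
    (F : GCSub A part) (hF : F.IsFactor) (c' : ℕ)
    (hc' : c' = (Finset.univ.filter fun k : Fin c =>
      2 ≤ (Finset.univ.filter fun v : V => part v = k).card).card) :
    (∃ C : GCycle A part, (∀ v : V, v ∈ C.toGPath.verts) ∧ F.arcs ≤ C.len + 2 * c') ∧
    (c' = 1 → ∃ C : GCycle A part, (∀ v : V, v ∈ C.toGPath.verts) ∧ F.arcs ≤ C.len + 1) := by
  have hT : ∀ a b : V, a ≠ b → part a = part b →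
      part a ∈ Finset.univ.filter fun k : Fin c =>
        2 ≤ (Finset.univ.filter fun v : V => part v = k).card := by
    intro a b hab h
    rw [Finset.mem_filter]
    exact ⟨Finset.mem_univ _, Finset.one_lt_card.2 ⟨a, by simp, b, by simp [h], hab⟩⟩
  obtain ⟨C, hC, hcost⟩ := exists_spanning_gCycle hSMD hstrong F hF _ hT
  rw [← hc'] at hcost
  exact ⟨⟨C, hC, by omega⟩, fun h => ⟨C, hC, by omega⟩⟩
end
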